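/- arXiv:1901.04127 — 2 statements merged into one kernel-verified Lean document; each statement's English description precedes it below -/
import Mathlib

section
/- Let {X_n, n≥1} be a φ-mixing sequence of random variables with mixing coefficients satisfying φ(n)=O(n^{-3}). Fix p ∈ (0,1) and assume the common marginal distribution function F possesses a positive continuous density f in a neighborhood N_p of ξ_p such that 0 < d = sup{f(x) : x ∈ N_p} < ∞. Let a_n be a sequence with a_n ∼ C_0 n^{-1/2} (log n)^{3/4} for some constant C_0 > 0, let D_n = [ξ_p − a_n, ξ_p + a_n], and let H_{p,n} = sup_{x ∈ D_n} |(F_n(x) − F(x)) − (F_n(ξ_p) − p)|. Then with probability 1, H_{p,n} ≤ (d + 4 C_3) n^{-3/4} log n for all n sufficiently large, where C_3 = 4[1 + 4 Σ_{n=1}^∞ φ^{1/2}(n)]. -/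
open MeasureTheory Filter Set

/-- The σ-algebra generated by the random variables `X i` for `i ∈ S`. -/
noncomputable def sigmaGen {Ω : Type*} (X : ℕ → Ω → ℝ) (S : Set ℕ) : MeasurableSpace Ω :=
  ⨆ i ∈ S, MeasurableSpace.comap (X i) inferInstance

/-- The φ-mixing coefficients of the sequence `X` with respect to the measure `μ`:
`φ(n) = sup_{k ≥ 1} sup { |P(B|A) - P(B)| : A ∈ σ(X_i, 1 ≤ i ≤ k), P(A) > 0,
B ∈ σ(X_i, i ≥ k + n) }`. -/
noncomputable def phiCoef {Ω : Type*} [MeasurableSpace Ω] (X : ℕ → Ω → ℝ)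
    (μ : Measure Ω) (n : ℕ) : ℝ :=
  sSup {r : ℝ | ∃ k : ℕ, 1 ≤ k ∧ ∃ A B : Set Ω,
    MeasurableSet[sigmaGen X {i | 1 ≤ i ∧ i ≤ k}] A ∧
    MeasurableSet[sigmaGen X {i | k + n ≤ i}] B ∧
    0 < μ A ∧
    r = |(μ (A ∩ B)).toReal / (μ A).toReal - (μ B).toReal|}

/-- The empirical distribution function `F_n(x) = n⁻¹ ∑_{i=1}^n I(X_i ≤ x)`. -/
noncomputable def empDF {Ω : Type*} (X : ℕ → Ω → ℝ) (n : ℕ) (ω : Ω) (x : ℝ) : ℝ :=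
  (n : ℝ)⁻¹ * ∑ i ∈ Finset.Icc 1 n, (if X i ω ≤ x then (1 : ℝ) else 0)

/-- The `p`-th quantile `F⁻¹(p) = inf {x : F(x) ≥ p}` of a distribution function `F`. -/
noncomputable def quantile (F : ℝ → ℝ) (p : ℝ) : ℝ :=
  sInf {x : ℝ | p ≤ F x}

/-- The sample `p`-th quantile `ξ_{p,n} = F_n⁻¹(p) = inf {x : F_n(x) ≥ p}`. -/
noncomputable def sampleQuantile {Ω : Type*} (X : ℕ → Ω → ℝ) (n : ℕ) (ω : Ω) (p : ℝ) : ℝ :=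
  sInf {x : ℝ | p ≤ empDF X n ω x}


section Mixing

variable {Ω : Type*} [mΩ : MeasurableSpace Ω] {μ : Measure Ω} {X : ℕ → Ω → ℝ}

lemma sigmaGen_le (hX : ∀ i, Measurable (X i)) (S : Set ℕ) : sigmaGen X S ≤ mΩ :=
  iSup₂_le fun i _ => (hX i).comap_le

omit mΩ in
lemma measurable_sigmaGen {S : Set ℕ} {i : ℕ} (hi : i ∈ S) : Measurable[sigmaGen X S] (X i) :=
  (comap_measurable (X i)).mono
    (le_iSup₂_of_le (f := fun i (_ : i ∈ S) => MeasurableSpace.comap (X i) inferInstance)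
      i hi le_rfl) le_rfl

lemma phiCoef_nonneg (n : ℕ) : 0 ≤ phiCoef X μ n :=
  Real.sSup_nonneg <| by rintro r ⟨_, _, _, _, _, _, _, rfl⟩; positivity

lemma abs_measureReal_inter_sub_le [IsProbabilityMeasure μ] {k n : ℕ} {A B : Set Ω} (hk : 1 ≤ k)
    (hA : MeasurableSet[sigmaGen X {i | 1 ≤ i ∧ i ≤ k}] A)
    (hB : MeasurableSet[sigmaGen X {i | k + n ≤ i}] B) :
    |μ.real (A ∩ B) - μ.real A * μ.real B| ≤ phiCoef X μ n * μ.real A := by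
  rcases eq_or_ne (μ A) 0 with h0 | h0
  · have h1 : μ.real A = 0 := by simp [measureReal_def, h0]
    have h2 : μ.real (A ∩ B) = 0 :=
      le_antisymm (h1 ▸ measureReal_mono inter_subset_left) measureReal_nonneg
    simp [h1, h2]
  have hpos : 0 < μ.real A := ENNReal.toReal_pos h0 (measure_ne_top _ _)
  have hle : |μ.real (A ∩ B) / μ.real A - μ.real B| ≤ phiCoef X μ n := by
    refine le_csSup ⟨1, ?_⟩ ⟨k, hk, A, B, hA, hB, pos_iff_ne_zero.mpr h0, rfl⟩
    rintro r ⟨_, _, A', B', _, _, _, rfl⟩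
    have h1 : (μ (A' ∩ B')).toReal / (μ A').toReal ≤ 1 :=
      div_le_one_of_le₀ (measureReal_mono (μ := μ) inter_subset_left) ENNReal.toReal_nonneg
    have h2 : 0 ≤ (μ (A' ∩ B')).toReal / (μ A').toReal := by positivity
    have h3 : (μ B').toReal ≤ 1 := measureReal_le_one
    have h4 : 0 ≤ (μ B').toReal := ENNReal.toReal_nonneg
    exact abs_sub_le_iff.mpr ⟨by linarith, by linarith⟩
  calc |μ.real (A ∩ B) - μ.real A * μ.real B|
      = |μ.real (A ∩ B) / μ.real A - μ.real B| * μ.real A := by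
        rw [← abs_of_pos hpos, ← abs_mul, abs_of_pos hpos]
        congr 1
        field_simp
    _ ≤ _ := by gcongr

lemma measure_inter_le [IsProbabilityMeasure μ] {k n : ℕ} {A B : Set Ω} (hk : 1 ≤ k)
    (hA : MeasurableSet[sigmaGen X {i | 1 ≤ i ∧ i ≤ k}] A)
    (hB : MeasurableSet[sigmaGen X {i | k + n ≤ i}] B) :
    μ (A ∩ B) ≤ (μ B + ENNReal.ofReal (phiCoef X μ n)) * μ A := by
  have h := (abs_le.mp (abs_measureReal_inter_sub_le (μ := μ) hk hA hB)).2
  rw [← ofReal_measureReal, ← ofReal_measureReal (s := B), ← ofReal_measureReal (s := A),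
    ← ENNReal.ofReal_add measureReal_nonneg (phiCoef_nonneg n),
    ← ENNReal.ofReal_mul (add_nonneg measureReal_nonneg (phiCoef_nonneg n))]
  exact ENNReal.ofReal_le_ofReal (by linarith)

lemma setLIntegral_le_of_past [IsProbabilityMeasure μ] (hX : ∀ i, Measurable (X i)) {k n : ℕ}
    (hk : 1 ≤ k) {Z : Ω → ENNReal} {B : Set Ω}
    (hZ : Measurable[sigmaGen X {i | 1 ≤ i ∧ i ≤ k}] Z)
    (hB : MeasurableSet[sigmaGen X {i | k + n ≤ i}] B) :
    ∫⁻ ω in B, Z ω ∂μ ≤ (μ B + ENNReal.ofReal (phiCoef X μ n)) * ∫⁻ ω, Z ω ∂μ := by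
  have hm := sigmaGen_le hX {i | 1 ≤ i ∧ i ≤ k}
  rw [← lintegral_trim hm hZ, ← lintegral_trim hm hZ, ← smul_eq_mul,
    ← lintegral_smul_measure]
  refine lintegral_mono' (Measure.le_intro fun A hA _ => ?_) le_rfl
  rw [Measure.smul_apply, trim_measurableSet_eq hm hA, trim_measurableSet_eq hm hA,
    Measure.restrict_apply (hm _ hA)]
  exact measure_inter_le hk hA hB

lemma lintegral_mul_le_of_past_of_future [IsProbabilityMeasure μ] (hX : ∀ i, Measurable (X i))
    {k n : ℕ} (hk : 1 ≤ k) {Z : Ω → ENNReal} {W : Ω → ℝ} {M : ℝ}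
    (hZ : Measurable[sigmaGen X {i | 1 ≤ i ∧ i ≤ k}] Z)
    (hW : Measurable[sigmaGen X {i | k + n ≤ i}] W) (hW0 : ∀ ω, 0 ≤ W ω) (hWM : ∀ ω, W ω ≤ M) :
    ∫⁻ ω, Z ω * ENNReal.ofReal (W ω) ∂μ ≤
      (∫⁻ ω, ENNReal.ofReal (W ω) ∂μ + ENNReal.ofReal (phiCoef X μ n) * ENNReal.ofReal M) *
        ∫⁻ ω, Z ω ∂μ := by
  have hZ' : Measurable Z := hZ.mono (sigmaGen_le hX _) le_rfl
  have hW' : Measurable W := hW.mono (sigmaGen_le hX _) le_rfl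
  have hmeas : Measurable fun t : ℝ => μ {ω | t ≤ W ω} :=
    Antitone.measurable fun s t hst => measure_mono fun ω (h : t ≤ W ω) => hst.trans h
  have hind : Measurable fun t =>
      (Set.Iic M).indicator (fun _ => ENNReal.ofReal (phiCoef X μ n)) t :=
    measurable_const.indicator measurableSet_Iic
  calc ∫⁻ ω, Z ω * ENNReal.ofReal (W ω) ∂μ
      = ∫⁻ ω, ENNReal.ofReal (W ω) ∂(μ.withDensity Z) :=
        (lintegral_withDensity_eq_lintegral_mul μ hZ' hW'.ennreal_ofReal).symm
    _ = ∫⁻ t in Ioi (0 : ℝ), μ.withDensity Z {ω | t ≤ W ω} :=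
        lintegral_eq_lintegral_meas_le _ (Eventually.of_forall hW0) hW'.aemeasurable
    _ ≤ ∫⁻ t in Ioi (0 : ℝ), (μ {ω | t ≤ W ω} +
          (Set.Iic M).indicator (fun _ => ENNReal.ofReal (phiCoef X μ n)) t) * ∫⁻ ω, Z ω ∂μ := by
        refine lintegral_mono fun t => ?_
        rw [withDensity_apply _ (measurableSet_le measurable_const hW')]
        by_cases ht : t ≤ M
        · simp only [Set.indicator_of_mem (show t ∈ Set.Iic M from ht)]
          exact setLIntegral_le_of_past hX hk hZ (hW measurableSet_Ici)
        · have : {ω | t ≤ W ω} = ∅ :=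
            eq_empty_of_forall_notMem fun ω h => ht (le_trans h (hWM ω))
          simp [this]
    _ = _ := by
        rw [lintegral_mul_const _ (by exact hmeas.add hind), lintegral_add_right _ hind,
          ← lintegral_eq_lintegral_meas_le _ (Eventually.of_forall hW0) hW'.aemeasurable,
          lintegral_indicator measurableSet_Iic, setLIntegral_const,
          Measure.restrict_apply measurableSet_Iic, Set.inter_comm, Set.Ioi_inter_Iic,
          Real.volume_Ioc, sub_zero]

/-- The mixing coefficients as a function of a signed lag, with value `1` at lag zero. -/
noncomputable def lagWeight (X : ℕ → Ω → ℝ) (μ : Measure Ω) (z : ℤ) : ℝ :=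
  if z = 0 then 1 else phiCoef X μ z.natAbs

lemma lagWeight_nonneg (z : ℤ) : 0 ≤ lagWeight X μ z := by
  unfold lagWeight
  split_ifs
  exacts [zero_le_one, phiCoef_nonneg _]

lemma summable_lagWeight (h : Summable (phiCoef X μ)) : Summable (lagWeight X μ) := by
  have h1 : Summable fun n : ℕ => lagWeight X μ n := by
    refine h.congr_cofinite ?_
    filter_upwards [(Set.finite_singleton 0).compl_mem_cofinite] with n hn
    have : n ≠ 0 := by simpa using hn
    simp [lagWeight, this]
  refine Summable.of_nat_of_neg h1 (h1.congr fun n => ?_)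
  simp [lagWeight]

/-- The indicator of `I`, recentred by `v`. -/
noncomputable def centredIndicator (I : Set ℝ) (v : ℝ) (x : ℝ) : ℝ := I.indicator 1 x - v

lemma measurable_centredIndicator {I : Set ℝ} (hI : MeasurableSet I) (v : ℝ) :
    Measurable (centredIndicator I v) :=
  (measurable_one.indicator hI).sub_const v

lemma abs_centredIndicator_le {I : Set ℝ} {v : ℝ} (h0 : 0 ≤ v) (h1 : v ≤ 1) (x : ℝ) :
    |centredIndicator I v x| ≤ 1 := by
  unfold centredIndicator
  by_cases hx : x ∈ I <;> simp [hx, abs_le] <;> constructor <;> linarith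

variable {I : Set ℝ} {v : ℝ}

lemma nonneg_of_marginal (hv : ∀ i, 1 ≤ i → μ.real (X i ⁻¹' I) = v) : 0 ≤ v :=
  hv 1 le_rfl ▸ measureReal_nonneg

variable [IsProbabilityMeasure μ]

lemma le_one_of_marginal (hv : ∀ i, 1 ≤ i → μ.real (X i ⁻¹' I) = v) : v ≤ 1 :=
  hv 1 le_rfl ▸ measureReal_le_one

lemma integral_centredIndicator (hX : ∀ i, Measurable (X i)) (hI : MeasurableSet I)
    (hv : ∀ i, 1 ≤ i → μ.real (X i ⁻¹' I) = v) {i : ℕ} (hi : 1 ≤ i) :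
    ∫ ω, centredIndicator I v (X i ω) ∂μ = 0 := by
  have hA := hX i hI
  have : ∀ ω, centredIndicator I v (X i ω) = (X i ⁻¹' I).indicator 1 ω - v := fun ω => rfl
  simp_rw [this]
  have iA : Integrable ((X i ⁻¹' I).indicator (1 : Ω → ℝ)) μ := (integrable_const 1).indicator hA
  rw [integral_sub iA (integrable_const v), integral_indicator_one hA, hv i hi]
  simp

lemma integral_centredIndicator_mul (hX : ∀ i, Measurable (X i)) (hI : MeasurableSet I)
    (hv : ∀ i, 1 ≤ i → μ.real (X i ⁻¹' I) = v) {i j : ℕ} (hi : 1 ≤ i) (hj : 1 ≤ j) :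
    ∫ ω, centredIndicator I v (X i ω) * centredIndicator I v (X j ω) ∂μ =
      μ.real (X i ⁻¹' I ∩ X j ⁻¹' I) - μ.real (X i ⁻¹' I) * μ.real (X j ⁻¹' I) := by
  have hA := hX i hI
  have hB := hX j hI
  have h : ∀ ω, centredIndicator I v (X i ω) * centredIndicator I v (X j ω) =
      (X i ⁻¹' I ∩ X j ⁻¹' I).indicator 1 ω - v * (X i ⁻¹' I).indicator 1 ω
        - v * (X j ⁻¹' I).indicator 1 ω + v * v := fun ω => by
    by_cases h1 : X i ω ∈ I <;> by_cases h2 : X j ω ∈ I <;>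
      simp [centredIndicator, h1, h2] <;> ring
  have iA : Integrable ((X i ⁻¹' I).indicator (1 : Ω → ℝ)) μ := (integrable_const 1).indicator hA
  have iB : Integrable ((X j ⁻¹' I).indicator (1 : Ω → ℝ)) μ := (integrable_const 1).indicator hB
  have iAB : Integrable ((X i ⁻¹' I ∩ X j ⁻¹' I).indicator (1 : Ω → ℝ)) μ :=
    (integrable_const 1).indicator (hA.inter hB)
  simp_rw [h]
  rw [integral_add (by exact (iAB.sub (iA.const_mul v)).sub (iB.const_mul v)) (integrable_const _),
    integral_sub (by exact iAB.sub (iA.const_mul v)) (iB.const_mul v),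
    integral_sub iAB (iA.const_mul v), integral_const_mul, integral_const_mul,
    integral_indicator_one hA, integral_indicator_one hB, integral_indicator_one (hA.inter hB),
    hv i hi, hv j hj]
  simp

lemma integral_centredIndicator_mul_le (hX : ∀ i, Measurable (X i)) (hI : MeasurableSet I)
    (hv : ∀ i, 1 ≤ i → μ.real (X i ⁻¹' I) = v) {i j : ℕ} (hi : 1 ≤ i) (hj : 1 ≤ j) :
    ∫ ω, centredIndicator I v (X i ω) * centredIndicator I v (X j ω) ∂μ ≤
      v * lagWeight X μ ((j : ℤ) - i) := by
  have key : ∀ {i j : ℕ}, 1 ≤ i → i < j →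
      ∫ ω, centredIndicator I v (X i ω) * centredIndicator I v (X j ω) ∂μ ≤
        v * phiCoef X μ (j - i) := by
    intro i j hi hij
    rw [integral_centredIndicator_mul hX hI hv hi (by omega)]
    have h := abs_measureReal_inter_sub_le (X := X) (μ := μ) (k := i) (n := j - i)
      (A := X i ⁻¹' I) (B := X j ⁻¹' I) hi (measurable_sigmaGen (by simpa using hi) hI)
      (measurable_sigmaGen (show i + (j - i) ≤ j by omega) hI)
    rw [hv i hi] at h ⊢
    linarith [le_abs_self (μ.real (X i ⁻¹' I ∩ X j ⁻¹' I) - v * μ.real (X j ⁻¹' I))]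
  rcases lt_trichotomy i j with hij | rfl | hij
  · have h1 : ((j : ℤ) - i) ≠ 0 := by omega
    have h2 : ((j : ℤ) - i).natAbs = j - i := by omega
    simpa [lagWeight, h1, h2] using key hi hij
  · rw [integral_centredIndicator_mul hX hI hv hi hi, Set.inter_self, hv i hi]
    simp only [lagWeight, sub_self, if_true]
    nlinarith [mul_self_nonneg v]
  · have h1 : ((j : ℤ) - i) ≠ 0 := by omega
    have h2 : ((j : ℤ) - i).natAbs = i - j := by omega
    simpa [lagWeight, h1, h2, mul_comm] using key hj hij

lemma integrable_of_measurable_of_abs_le {Y : Ω → ℝ} {M : ℝ} (hY : Measurable Y)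
    (h : ∀ ω, |Y ω| ≤ M) : Integrable Y μ :=
  Integrable.of_bound hY.aestronglyMeasurable M (Eventually.of_forall h)

omit mΩ in
lemma measurable_blockSum {m : MeasurableSpace Ω} {s : Finset ℕ} (hI : MeasurableSet I)
    (hs : ∀ i ∈ s, Measurable[m] (X i)) :
    Measurable[m] fun ω => ∑ i ∈ s, centredIndicator I v (X i ω) :=
  Finset.measurable_sum _ fun i hi => (measurable_centredIndicator hI v).comp (hs i hi)

omit mΩ in
lemma abs_blockSum_le (h0 : 0 ≤ v) (h1 : v ≤ 1) (s : Finset ℕ) (ω : Ω) :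
    |∑ i ∈ s, centredIndicator I v (X i ω)| ≤ s.card := by
  refine (Finset.abs_sum_le_sum_abs _ _).trans ?_
  simpa using Finset.sum_le_sum fun i (_ : i ∈ s) =>
    abs_centredIndicator_le (I := I) h0 h1 (X i ω)

lemma integral_sq_blockSum_le (hX : ∀ i, Measurable (X i)) (hI : MeasurableSet I)
    (hv : ∀ i, 1 ≤ i → μ.real (X i ⁻¹' I) = v) (hsum : Summable (phiCoef X μ))
    {s : Finset ℕ} (hs : ∀ i ∈ s, 1 ≤ i) :
    ∫ ω, (∑ i ∈ s, centredIndicator I v (X i ω)) ^ 2 ∂μ ≤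
      s.card * (v * ∑' z, lagWeight X μ z) := by
  have h0 := nonneg_of_marginal hv
  have h1 := le_one_of_marginal hv
  have hm : ∀ i, Measurable fun ω => centredIndicator I v (X i ω) :=
    fun i => (measurable_centredIndicator hI v).comp (hX i)
  have hint : ∀ i j, Integrable
      (fun ω => centredIndicator I v (X i ω) * centredIndicator I v (X j ω)) μ := fun i j =>
    integrable_of_measurable_of_abs_le (M := 1) ((hm i).mul (hm j)) fun ω => by
      rw [abs_mul]
      exact mul_le_one₀ (abs_centredIndicator_le h0 h1 _) (abs_nonneg _)
        (abs_centredIndicator_le h0 h1 _)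
  simp_rw [sq, Finset.sum_mul_sum]
  rw [integral_finsetSum _ fun i _ => integrable_finsetSum _ fun j _ => hint i j,
    ← nsmul_eq_mul]
  refine Finset.sum_le_card_nsmul _ _ _ fun i hi => ?_
  rw [integral_finsetSum _ fun j _ => hint i j]
  calc ∑ j ∈ s, ∫ ω, centredIndicator I v (X i ω) * centredIndicator I v (X j ω) ∂μ
      ≤ ∑ j ∈ s, v * lagWeight X μ ((j : ℤ) - i) := Finset.sum_le_sum fun j hj =>
        integral_centredIndicator_mul_le hX hI hv (hs i hi) (hs j hj)
    _ = v * ∑ z ∈ s.image fun j : ℕ => (j : ℤ) - i, lagWeight X μ z := by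
        rw [Finset.mul_sum, Finset.sum_image fun a _ b _ h => by simpa using h]
    _ ≤ _ := by
        gcongr
        exact (summable_lagWeight hsum).sum_le_tsum _ fun z _ => lagWeight_nonneg z

lemma lintegral_exp_blockSum_le (hX : ∀ i, Measurable (X i)) (hI : MeasurableSet I)
    (hv : ∀ i, 1 ≤ i → μ.real (X i ⁻¹' I) = v) (hsum : Summable (phiCoef X μ))
    {s : Finset ℕ} (hs : ∀ i ∈ s, 1 ≤ i) {q : ℕ} (hq : s.card ≤ q) {l : ℝ} (hl : |l| * q ≤ 1) :
    ∫⁻ ω, ENNReal.ofReal (Real.exp (l * ∑ i ∈ s, centredIndicator I v (X i ω))) ∂μ ≤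
      ENNReal.ofReal (1 + l ^ 2 * (q * (v * ∑' z, lagWeight X μ z))) := by
  have h0 := nonneg_of_marginal hv
  have h1 := le_one_of_marginal hv
  set U : Ω → ℝ := fun ω => ∑ i ∈ s, centredIndicator I v (X i ω) with hU
  have hUm : Measurable U := measurable_blockSum hI fun i _ => hX i
  have hUq : ∀ ω, |U ω| ≤ q := fun ω =>
    (abs_blockSum_le h0 h1 s ω).trans (by exact_mod_cast hq)
  have hlU : ∀ ω, |l * U ω| ≤ 1 := fun ω => by
    rw [abs_mul]
    exact (mul_le_mul_of_nonneg_left (hUq ω) (abs_nonneg l)).trans hl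
  have hU1 : Integrable U μ := integrable_of_measurable_of_abs_le hUm hUq
  have hU2 : Integrable (fun ω => U ω ^ 2) μ :=
    integrable_of_measurable_of_abs_le (M := (q : ℝ) ^ 2) (hUm.pow_const 2) fun ω => by
      rw [abs_pow]
      exact pow_le_pow_left₀ (abs_nonneg _) (hUq ω) 2
  have hU0 : ∫ ω, U ω ∂μ = 0 := by
    rw [hU, integral_finsetSum _ fun i _ => integrable_of_measurable_of_abs_le
      (by exact (measurable_centredIndicator hI v).comp (hX i)) fun ω => abs_centredIndicator_le h0 h1 _]
    exact Finset.sum_eq_zero fun i hi => integral_centredIndicator hX hI hv (hs i hi)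
  have hb : ∀ ω, Real.exp (l * U ω) ≤ 1 + l * U ω + l ^ 2 * U ω ^ 2 := fun ω => by
    have := (abs_le.mp (Real.abs_exp_sub_one_sub_id_le (hlU ω))).2
    linarith [mul_pow l (U ω) 2]
  have hint : Integrable (fun ω => 1 + l * U ω + l ^ 2 * U ω ^ 2) μ :=
    ((integrable_const 1).add (hU1.const_mul l)).add (hU2.const_mul _)
  calc ∫⁻ ω, ENNReal.ofReal (Real.exp (l * U ω)) ∂μ
      ≤ ∫⁻ ω, ENNReal.ofReal (1 + l * U ω + l ^ 2 * U ω ^ 2) ∂μ :=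
        lintegral_mono fun ω => ENNReal.ofReal_le_ofReal (hb ω)
    _ = ENNReal.ofReal (∫ ω, (1 + l * U ω + l ^ 2 * U ω ^ 2) ∂μ) :=
        (ofReal_integral_eq_lintegral_ofReal hint
          (Eventually.of_forall fun ω => (Real.exp_pos _).le.trans (hb ω))).symm
    _ ≤ _ := by
        refine ENNReal.ofReal_le_ofReal ?_
        rw [integral_add (by exact (integrable_const 1).add (hU1.const_mul l)) (hU2.const_mul _),
          integral_add (integrable_const 1) (hU1.const_mul l), integral_const_mul,
          integral_const_mul, hU0]
        have h2 := integral_sq_blockSum_le hX hI hv hsum hs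
        have h3 : (s.card : ℝ) * (v * ∑' z, lagWeight X μ z) ≤
            q * (v * ∑' z, lagWeight X μ z) := by
          gcongr
          exact mul_nonneg h0 (tsum_nonneg fun z => lagWeight_nonneg z)
        have h4 := mul_le_mul_of_nonneg_left (h2.trans h3) (sq_nonneg l)
        simpa using h4

lemma lintegral_exp_sum_blocks_le (hX : ∀ i, Measurable (X i)) (hI : MeasurableSet I)
    (hv : ∀ i, 1 ≤ i → μ.real (X i ⁻¹' I) = v) (hsum : Summable (phiCoef X μ))
    {s : ℕ → Finset ℕ} {m : ℕ → ℕ} {q : ℕ} (hm1 : ∀ j, 1 ≤ m j) (hm : Monotone m)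
    (hs1 : ∀ j, ∀ i ∈ s j, 1 ≤ i) (hsm : ∀ j, ∀ i ∈ s j, i ≤ m j)
    (hgap : ∀ j, ∀ i ∈ s (j + 1), m j + q ≤ i) (hcard : ∀ j, (s j).card ≤ q)
    {l : ℝ} (hl : |l| * q ≤ 1) (r : ℕ) :
    ∫⁻ ω, ENNReal.ofReal (Real.exp
        (l * ∑ j ∈ Finset.range r, ∑ i ∈ s j, centredIndicator I v (X i ω))) ∂μ ≤
      ENNReal.ofReal (Real.exp
        (r * (l ^ 2 * (q * (v * ∑' z, lagWeight X μ z)) + 3 * phiCoef X μ q))) := by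
  have h0 := nonneg_of_marginal hv
  have h1 := le_one_of_marginal hv
  set c : ℝ := l ^ 2 * (q * (v * ∑' z, lagWeight X μ z)) with hc
  have hc0 : 0 ≤ c := by
    have : 0 ≤ ∑' z, lagWeight X μ z := tsum_nonneg fun z => lagWeight_nonneg z
    positivity
  have hphi := phiCoef_nonneg (X := X) (μ := μ) q
  have hfac : ENNReal.ofReal (1 + c) + ENNReal.ofReal (phiCoef X μ q) * ENNReal.ofReal 3 ≤
      ENNReal.ofReal (Real.exp (c + 3 * phiCoef X μ q)) := by
    rw [← ENNReal.ofReal_mul hphi, ← ENNReal.ofReal_add (by positivity) (by positivity)]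
    exact ENNReal.ofReal_le_ofReal
      (by linarith [Real.add_one_le_exp (c + 3 * phiCoef X μ q)])
  have hone : 1 ≤ ENNReal.ofReal (Real.exp (c + 3 * phiCoef X μ q)) := by
    rw [ENNReal.one_le_ofReal]
    exact Real.one_le_exp (by positivity)
  have hblock : ∀ j, ∫⁻ ω, ENNReal.ofReal
      (Real.exp (l * ∑ i ∈ s j, centredIndicator I v (X i ω))) ∂μ ≤ ENNReal.ofReal (1 + c) :=
    fun j => lintegral_exp_blockSum_le hX hI hv hsum (hs1 j) (hcard j) hl
  induction r with
  | zero => simp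
  | succ r ih =>
    have hexp : ∀ ω, ENNReal.ofReal (Real.exp
        (l * ∑ j ∈ Finset.range (r + 1), ∑ i ∈ s j, centredIndicator I v (X i ω))) =
        ENNReal.ofReal (Real.exp
          (l * ∑ j ∈ Finset.range r, ∑ i ∈ s j, centredIndicator I v (X i ω))) *
        ENNReal.ofReal (Real.exp (l * ∑ i ∈ s r, centredIndicator I v (X i ω))) := fun ω => by
      rw [Finset.sum_range_succ, mul_add, Real.exp_add, ENNReal.ofReal_mul (Real.exp_pos _).le]
    have hsplit : ENNReal.ofReal (Real.exp (((r + 1 : ℕ) : ℝ) * (c + 3 * phiCoef X μ q))) =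
        ENNReal.ofReal (Real.exp (c + 3 * phiCoef X μ q)) *
          ENNReal.ofReal (Real.exp (r * (c + 3 * phiCoef X μ q))) := by
      rw [← ENNReal.ofReal_mul (Real.exp_pos _).le, ← Real.exp_add]
      push_cast
      ring_nf
    simp_rw [hexp]
    rw [hsplit]
    rcases r with _ | r
    · simpa using ((hblock 0).trans le_self_add).trans hfac
    · refine (lintegral_mul_le_of_past_of_future (k := m r) (n := q) (M := 3) hX (hm1 r)
        (W := fun ω => Real.exp (l * ∑ i ∈ s (r + 1), centredIndicator I v (X i ω)))
        ?_ ?_ (fun ω => (Real.exp_pos _).le) fun ω => ?_).trans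
          (mul_le_mul' ((add_le_add_left (hblock _) _).trans hfac) ih)
      · refine (Real.measurable_exp.comp ((Finset.measurable_sum _ fun j hj =>
          measurable_blockSum hI fun i hi => measurable_sigmaGen ?_).const_mul l)).ennreal_ofReal
        exact ⟨hs1 j i hi, (hsm j i hi).trans (hm (by simpa [Nat.lt_succ_iff] using hj))⟩
      · exact Real.measurable_exp.comp ((measurable_blockSum hI fun i hi =>
          measurable_sigmaGen (hgap r i hi)).const_mul l)
      · have hle : l * ∑ i ∈ s (r + 1), centredIndicator I v (X i ω) ≤ 1 := by
          refine (le_abs_self _).trans ?_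
          rw [abs_mul]
          refine le_trans (mul_le_mul_of_nonneg_left ?_ (abs_nonneg l)) hl
          exact (abs_blockSum_le h0 h1 _ ω).trans (by exact_mod_cast hcard _)
        exact (Real.exp_le_exp.mpr hle).trans (by linarith [Real.exp_one_lt_d9])

lemma measure_le_mul_sum_blocks_le (hX : ∀ i, Measurable (X i)) (hI : MeasurableSet I)
    (hv : ∀ i, 1 ≤ i → μ.real (X i ⁻¹' I) = v) (hsum : Summable (phiCoef X μ))
    {s : ℕ → Finset ℕ} {m : ℕ → ℕ} {q : ℕ} (hm1 : ∀ j, 1 ≤ m j) (hm : Monotone m)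
    (hs1 : ∀ j, ∀ i ∈ s j, 1 ≤ i) (hsm : ∀ j, ∀ i ∈ s j, i ≤ m j)
    (hgap : ∀ j, ∀ i ∈ s (j + 1), m j + q ≤ i) (hcard : ∀ j, (s j).card ≤ q)
    {l : ℝ} (hl : |l| * q ≤ 1) (r : ℕ) (t : ℝ) :
    μ {ω | t ≤ l * ∑ j ∈ Finset.range r, ∑ i ∈ s j, centredIndicator I v (X i ω)} ≤
      ENNReal.ofReal (Real.exp
        (-t + r * (l ^ 2 * (q * (v * ∑' z, lagWeight X μ z)) + 3 * phiCoef X μ q))) := by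
  have hmeas : Measurable fun ω => ENNReal.ofReal (Real.exp
      (l * ∑ j ∈ Finset.range r, ∑ i ∈ s j, centredIndicator I v (X i ω))) :=
    (Real.measurable_exp.comp ((Finset.measurable_sum _ fun j _ =>
      measurable_blockSum hI fun i _ => hX i).const_mul l)).ennreal_ofReal
  have hsub : {ω | t ≤ l * ∑ j ∈ Finset.range r, ∑ i ∈ s j, centredIndicator I v (X i ω)} ⊆
      {ω | ENNReal.ofReal (Real.exp t) ≤ ENNReal.ofReal (Real.exp
        (l * ∑ j ∈ Finset.range r, ∑ i ∈ s j, centredIndicator I v (X i ω)))} := fun ω hω =>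
    ENNReal.ofReal_le_ofReal (Real.exp_le_exp.mpr hω)
  refine (measure_mono hsub).trans ((meas_ge_le_lintegral_div hmeas.aemeasurable
    (by simp [Real.exp_pos]) ENNReal.ofReal_ne_top).trans ?_)
  rw [Real.exp_add, Real.exp_neg, ENNReal.ofReal_mul (by positivity),
    ENNReal.ofReal_inv_of_pos (Real.exp_pos t), mul_comm, ← div_eq_mul_inv]
  gcongr
  exact lintegral_exp_sum_blocks_le hX hI hv hsum hm1 hm hs1 hsm hgap hcard hl r

end Mixing

lemma sum_range_two_mul {M : Type*} [AddCommMonoid M] (g : ℕ → M) (r : ℕ) :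
    ∑ m ∈ Finset.range (2 * r), g m =
      ∑ j ∈ Finset.range r, g (2 * j) + ∑ j ∈ Finset.range r, g (2 * j + 1) := by
  induction r with
  | zero => simp
  | succ r ih =>
    rw [mul_add, mul_one, Finset.sum_range_succ, Finset.sum_range_succ, ih,
      Finset.sum_range_succ, Finset.sum_range_succ]
    abel

/-- The `m`-th block of length `q` of `{1, …, n}`. -/
def indexBlock (n q m : ℕ) : Finset ℕ := {i ∈ Finset.Icc 1 n | (i - 1) / q = m}

lemma bounds_of_mem_indexBlock {n q m i : ℕ} (hq : 0 < q) (hi : i ∈ indexBlock n q m) :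
    m * q + 1 ≤ i ∧ i ≤ m * q + q := by
  simp only [indexBlock, Finset.mem_filter, Finset.mem_Icc] at hi
  obtain ⟨⟨h1, h2⟩, h3⟩ := hi
  have h4 := (Nat.div_eq_iff hq).mp h3
  omega

lemma card_indexBlock_le {n q m : ℕ} (hq : 0 < q) : (indexBlock n q m).card ≤ q := by
  refine (Finset.card_le_card (t := Finset.Icc (m * q + 1) (m * q + q)) fun i hi => ?_).trans
    (by simp)
  simpa using bounds_of_mem_indexBlock hq hi

lemma sum_Icc_eq_sum_indexBlock (g : ℕ → ℝ) (n q : ℕ) :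
    ∑ i ∈ Finset.Icc 1 n, g i =
      ∑ j ∈ Finset.range (n / q + 1), ∑ i ∈ indexBlock n q (2 * j), g i +
      ∑ j ∈ Finset.range (n / q + 1), ∑ i ∈ indexBlock n q (2 * j + 1), g i := by
  rw [← sum_range_two_mul fun m => ∑ i ∈ indexBlock n q m, g i]
  refine (Finset.sum_fiberwise_of_maps_to (fun i hi => ?_) g).symm
  have h : (i - 1) / q ≤ n / q := Nat.div_le_div_right (by have := Finset.mem_Icc.mp hi; omega)
  simp only [Finset.mem_range]
  omega

/-- An exponential deviation inequality for the empirical measure of a set. -/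
lemma measure_deviation_le {Ω : Type*} [MeasurableSpace Ω] {μ : Measure Ω}
    [IsProbabilityMeasure μ] {X : ℕ → Ω → ℝ} (hX : ∀ i, Measurable (X i)) {I : Set ℝ} {v : ℝ}
    (hI : MeasurableSet I) (hv : ∀ i, 1 ≤ i → μ.real (X i ⁻¹' I) = v)
    (hsum : Summable (phiCoef X μ)) (n : ℕ) {q : ℕ} (hq : 0 < q) (t : ℝ) :
    μ {ω | 2 * t ≤ |∑ i ∈ Finset.Icc 1 n, centredIndicator I v (X i ω)|} ≤
      4 * ENNReal.ofReal (Real.exp (-(t / q) + ((n / q + 1 : ℕ) : ℝ) *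
        (v * (∑' z, lagWeight X μ z) / q + 3 * phiCoef X μ q))) := by
  have hq' : (0 : ℝ) < q := by exact_mod_cast hq
  set S : ℕ → Ω → ℝ := fun b ω => ∑ j ∈ Finset.range (n / q + 1),
    ∑ i ∈ indexBlock n q (2 * j + b), centredIndicator I v (X i ω) with hS
  set K := ENNReal.ofReal (Real.exp (-(t / q) + ((n / q + 1 : ℕ) : ℝ) *
    (v * (∑' z, lagWeight X μ z) / q + 3 * phiCoef X μ q))) with hK
  have hone : ∀ b : ℕ, ∀ l : ℝ, l ^ 2 = (q : ℝ)⁻¹ ^ 2 → |l| * q ≤ 1 →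
      μ {ω | t / q ≤ l * S b ω} ≤ K := by
    intro b l hl2 hl
    have h := measure_le_mul_sum_blocks_le (s := fun j => indexBlock n q (2 * j + b))
      (m := fun j => (2 * j + b) * q + q) (q := q) hX hI hv hsum (fun j => by omega)
      (fun i j hij => by dsimp only; gcongr)
      (fun j i hi => by have := bounds_of_mem_indexBlock hq hi; omega)
      (fun j i hi => (bounds_of_mem_indexBlock hq hi).2)
      (fun j i hi => by have := (bounds_of_mem_indexBlock hq hi).1; linarith)
      (fun j => card_indexBlock_le hq) hl (n / q + 1) (t / q)
    refine h.trans_eq ?_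
    rw [hK, hl2]
    congr 5
    field_simp
  have hl : |(q : ℝ)⁻¹| * q ≤ 1 := by rw [abs_of_pos (by positivity), inv_mul_cancel₀ hq'.ne']
  have hsub : {ω | 2 * t ≤ |∑ i ∈ Finset.Icc 1 n, centredIndicator I v (X i ω)|} ⊆
      ({ω | t / q ≤ (q : ℝ)⁻¹ * S 0 ω} ∪ {ω | t / q ≤ -(q : ℝ)⁻¹ * S 0 ω}) ∪
      ({ω | t / q ≤ (q : ℝ)⁻¹ * S 1 ω} ∪ {ω | t / q ≤ -(q : ℝ)⁻¹ * S 1 ω}) := by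
    intro ω hω
    have hdec : ∑ i ∈ Finset.Icc 1 n, centredIndicator I v (X i ω) = S 0 ω + S 1 ω :=
      sum_Icc_eq_sum_indexBlock (fun i => centredIndicator I v (X i ω)) n q
    have hdiv : ∀ y : ℝ, t ≤ y → t / q ≤ (q : ℝ)⁻¹ * y := fun y hy => by
      rw [← div_eq_inv_mul]; gcongr
    by_contra hcon
    simp only [mem_union, mem_ofPred_eq, not_or, neg_mul, ← mul_neg] at hcon hω
    have h1 := lt_of_not_ge fun h => hcon.1.1 (hdiv _ h)
    have h2 := lt_of_not_ge fun h => hcon.1.2 (hdiv _ h)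
    have h3 := lt_of_not_ge fun h => hcon.2.1 (hdiv _ h)
    have h4 := lt_of_not_ge fun h => hcon.2.2 (hdiv _ h)
    rw [hdec] at hω
    exact absurd hω (not_le.mpr (abs_lt.mpr ⟨by linarith, by linarith⟩))
  calc _ ≤ (K + K) + (K + K) := (measure_mono hsub).trans <|
        (measure_union_le _ _).trans <| add_le_add
          ((measure_union_le _ _).trans <| add_le_add (hone 0 _ rfl hl)
            (hone 0 _ (neg_sq _) (by rwa [abs_neg])))
          ((measure_union_le _ _).trans <| add_le_add (hone 1 _ rfl hl)
            (hone 1 _ (neg_sq _) (by rwa [abs_neg])))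
    _ = 4 * K := by ring

lemma apply_quantile_eq {F : ℝ → ℝ} {p : ℝ} (hmono : Monotone F)
    (htop : Tendsto F atTop (nhds 1)) (hbot : Tendsto F atBot (nhds 0)) (hp : 0 < p ∧ p < 1)
    (hc : ContinuousAt F (quantile F p)) : F (quantile F p) = p := by
  have hne : {x : ℝ | p ≤ F x}.Nonempty := (htop.eventually_const_le hp.2).exists
  have hbdd : BddBelow {x : ℝ | p ≤ F x} := by
    obtain ⟨y, hy⟩ := (hbot.eventually_lt_const hp.1).exists
    exact ⟨y, fun x hx => le_of_not_gt fun h => (hy.trans_le hx).not_ge (hmono h.le)⟩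
  rcases lt_trichotomy (F (quantile F p)) p with h | h | h
  · obtain ⟨y, hy, hlt⟩ := (((hc.eventually_lt_const h).filter_mono nhdsWithin_le_nhds).and
      (self_mem_nhdsWithin (s := Ioi (quantile F p)))).exists
    obtain ⟨z, hz, hzy⟩ := exists_lt_of_csInf_lt hne hlt
    exact absurd (hmono hzy.le) (not_le.mpr (hy.trans_le hz))
  · exact h
  · obtain ⟨y, hy, hlt⟩ := (((hc.eventually_const_lt h).filter_mono nhdsWithin_le_nhds).and
      (self_mem_nhdsWithin (s := Iio (quantile F p)))).exists
    exact absurd (csInf_le hbdd hy.le) (not_le.mpr hlt)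

lemma abs_sub_sub_le_of_grid {E F : ℝ → ℝ} (hE : Monotone E) {d ξ c a δ ε x : ℝ} (hδ : 0 < δ)
    (hd : 0 ≤ d)
    (hF : ∀ u w, |u - ξ| ≤ a + δ → |w - ξ| ≤ a + δ → u ≤ w → F w - F u ≤ d * (w - u))
    (hgrid : ∀ k : ℤ, |k * δ| ≤ a + δ → |E (ξ + k * δ) - F (ξ + k * δ) - c| ≤ ε)
    (hx : x ∈ Icc (ξ - a) (ξ + a)) : |E x - F x - c| ≤ d * δ + ε := by
  set k := ⌊(x - ξ) / δ⌋ with hk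
  have h1 : k * δ ≤ x - ξ := (le_div_iff₀ hδ).mp (Int.floor_le _)
  have h2 : x - ξ < (k + 1) * δ := (div_lt_iff₀ hδ).mp (Int.lt_floor_add_one _)
  obtain ⟨hx1, hx2⟩ := hx
  have hb1 : |(k : ℝ) * δ| ≤ a + δ := abs_le.mpr ⟨by linarith, by linarith⟩
  have hb2 : |((k + 1 : ℤ) : ℝ) * δ| ≤ a + δ := by
    push_cast
    exact abs_le.mpr ⟨by linarith, by linarith⟩
  have hbx : |x - ξ| ≤ a + δ := abs_le.mpr ⟨by linarith, by linarith⟩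
  have g1 := (abs_le.mp (hgrid k hb1)).1
  have g2 := (abs_le.mp (hgrid (k + 1) hb2)).2
  push_cast at g2 hb2
  have e1 : E (ξ + k * δ) ≤ E x := hE (by linarith)
  have e2 : E x ≤ E (ξ + (k + 1) * δ) := hE (by linarith)
  have f1 := hF (ξ + k * δ) x (by simpa using hb1) hbx (by linarith)
  have f2 := hF x (ξ + (k + 1) * δ) hbx (by simpa using hb2) (by linarith)
  have m1 : d * (x - (ξ + k * δ)) ≤ d * δ := by gcongr; linarith
  have m2 : d * (ξ + (k + 1) * δ - x) ≤ d * δ := by gcongr; linarith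
  exact abs_le.mpr ⟨by linarith, by linarith⟩

section Empirical

variable {Ω : Type*} {X : ℕ → Ω → ℝ}

lemma monotone_empDF (n : ℕ) (ω : Ω) : Monotone (empDF X n ω) := fun x y hxy => by
  unfold empDF
  gcongr with i
  split_ifs with h1 h2
  exacts [le_rfl, absurd (h1.trans hxy) h2, zero_le_one, le_rfl]

lemma sum_centredIndicator_Ioc {x y v : ℝ} (hxy : x ≤ y) {n : ℕ} (hn : n ≠ 0) (ω : Ω) :
    ∑ i ∈ Finset.Icc 1 n, centredIndicator (Ioc x y) v (X i ω) =
      n * (empDF X n ω y - empDF X n ω x - v) := by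
  have hn' : (n : ℝ) ≠ 0 := by exact_mod_cast hn
  have h : ∀ i, centredIndicator (Ioc x y) v (X i ω) =
      (if X i ω ≤ y then (1 : ℝ) else 0) - (if X i ω ≤ x then (1 : ℝ) else 0) - v := fun i => by
    unfold centredIndicator
    by_cases h1 : X i ω ≤ y <;> by_cases h2 : X i ω ≤ x <;>
      (simp [Set.indicator_apply, h1, h2]; try linarith)
  simp_rw [h, Finset.sum_sub_distrib]
  unfold empDF
  simp only [Finset.sum_const, Nat.card_Icc, nsmul_eq_mul, Nat.add_sub_cancel]
  field_simp

lemma abs_sum_centredIndicator_uIoc {F : ℝ → ℝ} (hF : Monotone F) (x y : ℝ) {n : ℕ} (hn : n ≠ 0)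
    (ω : Ω) :
    |∑ i ∈ Finset.Icc 1 n, centredIndicator (uIoc x y) |F y - F x| (X i ω)| =
      n * |empDF X n ω y - F y - (empDF X n ω x - F x)| := by
  rcases le_total x y with h | h
  · rw [uIoc_of_le h, sum_centredIndicator_Ioc h hn, abs_mul, Nat.abs_cast,
      abs_of_nonneg (sub_nonneg.mpr (hF h))]
    ring_nf
  · rw [uIoc_of_ge h, sum_centredIndicator_Ioc h hn, abs_mul, Nat.abs_cast, abs_sub_comm (F y),
      abs_of_nonneg (sub_nonneg.mpr (hF h)), abs_sub_comm (empDF X n ω y - F y)]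
    ring_nf

variable [MeasurableSpace Ω] {μ : Measure Ω} [IsProbabilityMeasure μ]

lemma measureReal_preimage_uIoc {F : ℝ → ℝ} {Y : Ω → ℝ} (hY : Measurable Y)
    (hF : ∀ x, F x = (μ {ω | Y ω ≤ x}).toReal) (x y : ℝ) :
    μ.real (Y ⁻¹' uIoc x y) = |F y - F x| := by
  have key : ∀ x y, x ≤ y → μ.real (Y ⁻¹' Ioc x y) = F y - F x := fun x y h => by
    rw [hF, hF, ← Iic_sdiff_Iic, preimage_sdiff]
    exact measureReal_sdiff (preimage_mono (Iic_subset_Iic.mpr h)) (hY measurableSet_Iic)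
  have hmono : ∀ x y, x ≤ y → F x ≤ F y := fun x y h =>
    sub_nonneg.mp ((key x y h).symm ▸ measureReal_nonneg)
  rcases le_total x y with h | h
  · rw [uIoc_of_le h, key x y h, abs_of_nonneg (sub_nonneg.mpr (hmono x y h))]
  · rw [uIoc_of_ge h, key y x h, abs_sub_comm, abs_of_nonneg (sub_nonneg.mpr (hmono y x h))]

lemma measureReal_deviation_le_of_fourth_root (hX : ∀ i, Measurable (X i)) {I : Set ℝ} {v : ℝ}
    (hI : MeasurableSet I) (hv : ∀ i, 1 ≤ i → μ.real (X i ⁻¹' I) = v)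
    (hsum : Summable (phiCoef X μ)) {n : ℕ} {s K L t : ℝ} (hs : 1 ≤ s) (hsn : s ^ 4 = n)
    (hK : phiCoef X μ ⌈s⌉₊ ≤ K * ((⌈s⌉₊ : ℝ) ^ 3)⁻¹) (hKL : 6 * K ≤ L / 2) (hL : 0 ≤ L)
    (hvL : 2 * (v * ∑' z, lagWeight X μ z) * s ^ 2 ≤ L / 2) (ht : 8 * s * L ≤ t) :
    μ.real {ω | 2 * t ≤ |∑ i ∈ Finset.Icc 1 n, centredIndicator I v (X i ω)|} ≤
      4 * Real.exp (-(3 * L)) := by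
  set q := ⌈s⌉₊ with hq
  set V := v * ∑' z, lagWeight X μ z with hV
  have hV0 : 0 ≤ V :=
    mul_nonneg (nonneg_of_marginal hv) (tsum_nonneg fun z => lagWeight_nonneg z)
  have hq0 : 0 < q := Nat.ceil_pos.mpr (by linarith)
  have hsq : s ≤ q := Nat.le_ceil s
  have hq1 : (1 : ℝ) ≤ q := hs.trans hsq
  have hq2 : (q : ℝ) ≤ 2 * s := by linarith [Nat.ceil_lt_add_one (by linarith : 0 ≤ s)]
  have hqn : (q : ℝ) ≤ n := by
    have : q ≤ n := Nat.ceil_le.mpr (hsn ▸ le_self_pow₀ hs (by norm_num))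
    exact_mod_cast this
  have h := measure_deviation_le hX hI hv hsum n hq0 t
  have h' := ENNReal.toReal_mono (by finiteness) h
  rw [ENNReal.toReal_mul, ENNReal.toReal_ofReal (Real.exp_pos _).le] at h'
  refine h'.trans ?_
  simp only [ENNReal.toReal_ofNat]
  gcongr
  have hr : ((n / q + 1 : ℕ) : ℝ) ≤ 2 * (s ^ 4 / q) := by
    push_cast
    have h1 : ((n / q : ℕ) : ℝ) ≤ n / q := Nat.cast_div_le
    have h2 : (1 : ℝ) ≤ n / q := (one_le_div (by positivity)).mpr hqn
    rw [hsn]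
    linarith
  have hsq2 : s ^ 2 ≤ (q : ℝ) ^ 2 := by gcongr
  have hsq4 : s ^ 4 ≤ (q : ℝ) ^ 4 := by gcongr
  have hK0 : 0 ≤ K := by
    by_contra hneg
    have : K * ((q : ℝ) ^ 3)⁻¹ < 0 := mul_neg_of_neg_of_pos (not_le.mp hneg) (by positivity)
    linarith [phiCoef_nonneg (X := X) (μ := μ) q]
  have hterm1 : 2 * (s ^ 4 / q) * (V / q) ≤ 2 * V * s ^ 2 := by
    rw [show 2 * (s ^ 4 / q) * (V / q) = 2 * V * s ^ 2 * (s ^ 2 / (q : ℝ) ^ 2) by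
      field_simp]
    exact mul_le_of_le_one_right (by positivity) ((div_le_one (by positivity)).mpr hsq2)
  have hterm2 : 2 * (s ^ 4 / q) * (3 * (K * ((q : ℝ) ^ 3)⁻¹)) ≤ 6 * K := by
    rw [show 2 * (s ^ 4 / q) * (3 * (K * ((q : ℝ) ^ 3)⁻¹)) = 6 * K * (s ^ 4 / (q : ℝ) ^ 4) by
      field_simp; ring]
    exact mul_le_of_le_one_right (by positivity) ((div_le_one (by positivity)).mpr hsq4)
  have hmul : ((n / q + 1 : ℕ) : ℝ) * (V / q + 3 * phiCoef X μ q) ≤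
      2 * (s ^ 4 / q) * (V / q + 3 * (K * ((q : ℝ) ^ 3)⁻¹)) := by
    have := phiCoef_nonneg (X := X) (μ := μ) q
    gcongr
  have htq : 4 * L ≤ t / q := by
    rw [le_div_iff₀ (by positivity)]
    nlinarith
  linarith [mul_add (2 * (s ^ 4 / q)) (V / q) (3 * (K * ((q : ℝ) ^ 3)⁻¹))]

end Empirical

lemma tendsto_log_natCast_atTop : Tendsto (fun n : ℕ => Real.log n) atTop atTop :=
  Real.tendsto_log_atTop.comp tendsto_natCast_atTop_atTop

lemma eventually_sqrt_mul_le_log {a : ℕ → ℝ} {C0 : ℝ} (hC0 : 0 < C0)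
    (ha : Tendsto (fun n : ℕ =>
      a n / (C0 * (n : ℝ) ^ (-(1 : ℝ) / 2) * Real.log n ^ ((3 : ℝ) / 4))) atTop (nhds 1))
    {c : ℝ} (hc : 0 < c) :
    ∀ᶠ n : ℕ in atTop, ((n : ℝ) ^ ((1 : ℝ) / 4)) ^ 2 *
      (a n + (n : ℝ) ^ (-(3 : ℝ) / 4) * Real.log n) ≤ c * Real.log n := by
  have h1 : Tendsto (fun n : ℕ => 2 * C0 * Real.log n ^ (-((1 : ℝ) / 4))) atTop (nhds 0) := by
    simpa using ((tendsto_rpow_neg_atTop (by norm_num : (0 : ℝ) < 1 / 4)).comp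
      tendsto_log_natCast_atTop).const_mul (2 * C0)
  have h2 : Tendsto (fun n : ℕ => (n : ℝ) ^ (-((1 : ℝ) / 4))) atTop (nhds 0) :=
    (tendsto_rpow_neg_atTop (by norm_num)).comp tendsto_natCast_atTop_atTop
  filter_upwards [ha.eventually_le_const (by norm_num : (1 : ℝ) < 2),
    h1.eventually_le_const (half_pos hc), h2.eventually_le_const (half_pos hc),
    tendsto_log_natCast_atTop.eventually_gt_atTop 0, eventually_gt_atTop 0] with n e1 e2 e3 hL hn
  have hn : (0 : ℝ) < n := by exact_mod_cast hn
  set L := Real.log n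
  rw [div_le_iff₀ (by positivity)] at e1
  have p1 : ((n : ℝ) ^ ((1 : ℝ) / 4)) ^ 2 * (n : ℝ) ^ (-(1 : ℝ) / 2) = 1 := by
    rw [← Real.rpow_natCast, ← Real.rpow_mul hn.le, ← Real.rpow_add hn]
    norm_num
  have p2 : ((n : ℝ) ^ ((1 : ℝ) / 4)) ^ 2 * (n : ℝ) ^ (-(3 : ℝ) / 4) = n ^ (-((1 : ℝ) / 4)) := by
    rw [← Real.rpow_natCast, ← Real.rpow_mul hn.le, ← Real.rpow_add hn]
    norm_num
  have p3 : L ^ ((3 : ℝ) / 4) = L ^ (-((1 : ℝ) / 4)) * L := by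
    rw [← Real.rpow_add_one hL.ne']
    norm_num
  calc ((n : ℝ) ^ ((1 : ℝ) / 4)) ^ 2 * (a n + (n : ℝ) ^ (-(3 : ℝ) / 4) * L)
      ≤ ((n : ℝ) ^ ((1 : ℝ) / 4)) ^ 2 * (2 * (C0 * (n : ℝ) ^ (-(1 : ℝ) / 2) * L ^ ((3 : ℝ) / 4)) +
          (n : ℝ) ^ (-(3 : ℝ) / 4) * L) := by gcongr
    _ = (((n : ℝ) ^ ((1 : ℝ) / 4)) ^ 2 * (n : ℝ) ^ (-(1 : ℝ) / 2)) *
          (2 * C0 * L ^ (-((1 : ℝ) / 4))) * L +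
        (((n : ℝ) ^ ((1 : ℝ) / 4)) ^ 2 * (n : ℝ) ^ (-(3 : ℝ) / 4)) * L := by rw [p3]; ring
    _ ≤ 1 * (c / 2) * L + c / 2 * L := by rw [p1, p2]; gcongr
    _ = c * L := by ring

lemma summable_phiCoef {Ω : Type*} [MeasurableSpace Ω] {μ : Measure Ω} {X : ℕ → Ω → ℝ}
    (hphi : (fun n : ℕ => phiCoef X μ n) =O[atTop] fun n : ℕ => ((n : ℝ) ^ 3)⁻¹) :
    Summable (phiCoef X μ) :=
  summable_of_isBigO_nat (Real.summable_nat_pow_inv.mpr (by norm_num)) hphi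

lemma abs_sub_le_mul_abs_sub_of_hasDerivAt {F f : ℝ → ℝ} {s : Set ℝ} {d : ℝ} (hs : Convex ℝ s)
    (hF : ∀ x ∈ s, HasDerivAt F (f x) x) (hf : ∀ x ∈ s, 0 ≤ f x) (hd : ∀ x ∈ s, f x ≤ d)
    {u w : ℝ} (hu : u ∈ s) (hw : w ∈ s) : |F w - F u| ≤ d * |w - u| :=
  hs.norm_image_sub_le_of_norm_hasDerivWithin_le (fun x hx => (hF x hx).hasDerivWithinAt)
    (fun x hx => by rw [Real.norm_of_nonneg (hf x hx)]; exact hd x hx) hu hw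

/-- **Theorem 2.1.** For a φ-mixing sequence with `φ(n) = O(n⁻³)` and a marginal
distribution function `F` with positive continuous density `f` near `ξ_p` with
`d = sup f` there, with probability 1,
`sup_{x ∈ [ξ_p - a_n, ξ_p + a_n]} |(F_n(x) - F(x)) - (F_n(ξ_p) - p)| ≤ (d + 4C₃) n^{-3/4} log n`
for all sufficiently large `n`, where `a_n ∼ C₀ n^{-1/2} (log n)^{3/4}` and
`C₃ = 4[1 + 4 ∑_{n=1}^∞ φ^{1/2}(n)]`. -/
theorem bahadur_thm_2_1 {Ω : Type*} [MeasurableSpace Ω] (μ : Measure Ω)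
    [IsProbabilityMeasure μ]
    (X : ℕ → Ω → ℝ) (hX : ∀ i, Measurable (X i))
    (hanti : Antitone (phiCoef X μ))
    (hmix : Tendsto (phiCoef X μ) atTop (nhds 0))
    (hphi : (fun n : ℕ => phiCoef X μ n) =O[atTop] fun n : ℕ => ((n : ℝ) ^ 3)⁻¹)
    (F : ℝ → ℝ) (hF : ∀ i, 1 ≤ i → ∀ x, F x = (μ {ω | X i ω ≤ x}).toReal)
    (p : ℝ) (hp : 0 < p ∧ p < 1)
    (Np : Set ℝ) (hNp : Np ∈ nhds (quantile F p))
    (f : ℝ → ℝ) (hfc : ContinuousOn f Np) (hfpos : ∀ x ∈ Np, 0 < f x)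
    (hFf : ∀ x ∈ Np, HasDerivAt F (f x) x)
    (d : ℝ) (hd : IsLUB (f '' Np) d) (hd0 : 0 < d)
    (C0 : ℝ) (hC0 : 0 < C0) (a : ℕ → ℝ)
    (ha : Tendsto (fun n : ℕ =>
      a n / (C0 * (n : ℝ) ^ (-(1 : ℝ) / 2) * Real.log n ^ ((3 : ℝ) / 4))) atTop (nhds 1))
    (C3 : ℝ) (hC3 : C3 = 4 * (1 + 4 * ∑' n : ℕ, Real.sqrt (phiCoef X μ (n + 1)))) :
    ∀ᵐ ω ∂μ, ∀ᶠ n : ℕ in atTop,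
      sSup ((fun x => |(empDF X n ω x - F x) - (empDF X n ω (quantile F p) - p)|) ''
          Set.Icc (quantile F p - a n) (quantile F p + a n)) ≤
        (d + 4 * C3) * (n : ℝ) ^ (-(3 : ℝ) / 4) * Real.log n := by
  have hp0 : ∀ n, 0 ≤ phiCoef X μ n := phiCoef_nonneg
  have hsum := summable_phiCoef hphi
  have hC34 : 4 ≤ C3 := by
    have : 0 ≤ ∑' n : ℕ, Real.sqrt (phiCoef X μ (n + 1)) :=
      tsum_nonneg fun n => Real.sqrt_nonneg _
    linarith
  set ξ := quantile F p with hξ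
  have hprob : IsProbabilityMeasure (μ.map (X 1)) :=
    Measure.isProbabilityMeasure_map (hX 1).aemeasurable
  have hcdf : F = ProbabilityTheory.cdf (μ.map (X 1)) := by
    ext x
    rw [ProbabilityTheory.cdf_eq_real, map_measureReal_apply (hX 1) measurableSet_Iic]
    exact hF 1 le_rfl x
  have hmono : Monotone F := hcdf ▸ ProbabilityTheory.monotone_cdf _
  have hFξ : F ξ = p := apply_quantile_eq hmono
    (hcdf ▸ ProbabilityTheory.tendsto_cdf_atTop _) (hcdf ▸ ProbabilityTheory.tendsto_cdf_atBot _)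
    hp (hFf ξ (mem_of_mem_nhds hNp)).continuousAt
  obtain ⟨ρ, hρ, hball⟩ := Metric.mem_nhds_iff.mp hNp
  have hlip : ∀ u w, |u - ξ| < ρ → |w - ξ| < ρ → |F w - F u| ≤ d * |w - u| := fun u w hu hw =>
    abs_sub_le_mul_abs_sub_of_hasDerivAt (convex_ball ξ ρ) (fun x hx => hFf x (hball hx))
      (fun x hx => (hfpos x (hball hx)).le) (fun x hx => hd.1 ⟨x, hball hx, rfl⟩)
      (Metric.mem_ball.mpr hu) (Metric.mem_ball.mpr hw)
  set s : ℕ → ℝ := fun n => (n : ℝ) ^ ((1 : ℝ) / 4) with hs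
  set δ : ℕ → ℝ := fun n => (n : ℝ) ^ (-(3 : ℝ) / 4) * Real.log n with hδ
  set T := ∑' z, lagWeight X μ z with hT
  have hT0 : 0 ≤ T := tsum_nonneg fun z => lagWeight_nonneg z
  obtain ⟨K, hK⟩ := hphi.bound
  have hs_top : Tendsto s atTop atTop :=
    (tendsto_rpow_atTop (by norm_num)).comp tendsto_natCast_atTop_atTop
  have hlog_div : Tendsto (fun n : ℕ => Real.log n / (n : ℝ) ^ ((1 : ℝ) / 2)) atTop (nhds 0) :=
    (isLittleO_log_rpow_atTop (by norm_num : (0 : ℝ) < 1 / 2)).tendsto_div_nhds_zero.comp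
      tendsto_natCast_atTop_atTop
  have hgood : ∀ᶠ n : ℕ in atTop, 1 < n ∧ 1 ≤ s n ∧ 0 < Real.log n ∧ 12 * K ≤ Real.log n ∧
      phiCoef X μ ⌈s n⌉₊ ≤ K * ((⌈s n⌉₊ : ℝ) ^ 3)⁻¹ ∧ a n + δ n < ρ ∧
      s n ^ 2 * (a n + δ n) ≤ Real.log n ∧
      s n ^ 2 * (a n + δ n) ≤ 1 / (4 * (T * d + 1)) * Real.log n := by
    filter_upwards [eventually_gt_atTop 1, hs_top.eventually_ge_atTop 1,
      tendsto_log_natCast_atTop.eventually_gt_atTop 0,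
      tendsto_log_natCast_atTop.eventually_ge_atTop (12 * K),
      (tendsto_nat_ceil_atTop.comp hs_top).eventually hK,
      hlog_div.eventually_lt_const hρ,
      eventually_sqrt_mul_le_log hC0 ha one_pos,
      eventually_sqrt_mul_le_log hC0 ha
        (show 0 < 1 / (4 * (T * d + 1)) by positivity)] with n e1 e2 e3 e4 e5 e6 e7 e8
    rw [one_mul] at e7
    refine ⟨e1, e2, e3, e4, ?_, ?_, e7, e8⟩
    · simpa [Real.norm_of_nonneg (hp0 _)] using e5
    · have hpow : s n ^ 2 = (n : ℝ) ^ ((1 : ℝ) / 2) := by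
        rw [hs]
        dsimp only
        rw [← Real.rpow_natCast, ← Real.rpow_mul (Nat.cast_nonneg n)]
        norm_num
      refine lt_of_le_of_lt ?_ e6
      rw [← hpow, le_div_iff₀ (by positivity), mul_comm]
      exact e7
  have hs4 : ∀ n : ℕ, s n ^ 4 = n := fun n => by
    rw [hs]
    dsimp only
    rw [← Real.rpow_natCast, ← Real.rpow_mul (Nat.cast_nonneg n)]
    norm_num
  have hδs : ∀ n : ℕ, 1 < n → n * δ n = s n * Real.log n := fun n hn => by
    have hn0 : (0 : ℝ) < n := by exact_mod_cast (zero_lt_one.trans hn)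
    rw [hδ, hs]
    dsimp only
    rw [← mul_assoc]
    congr 1
    nth_rewrite 1 [← Real.rpow_one (n : ℝ)]
    rw [← Real.rpow_add hn0]
    norm_num
  set grid : ℕ → Finset ℤ := fun n => {k ∈ Finset.Icc (-(n : ℤ)) n | |(k : ℝ) * δ n| ≤ a n + δ n}
    with hgrid
  set bad : ℕ → ℤ → Set Ω := fun n k => {ω | 2 * (2 * C3 * (s n * Real.log n)) ≤
    |∑ i ∈ Finset.Icc 1 n, centredIndicator (uIoc ξ (ξ + k * δ n))
      |F (ξ + k * δ n) - F ξ| (X i ω)|} with hbad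
  have hbad_le : ∀ᶠ n : ℕ in atTop, ∀ k ∈ grid n, μ.real (bad n k) ≤ 4 * ((n : ℝ) ^ 3)⁻¹ := by
    filter_upwards [hgood] with n ⟨e1, e2, e3, e4, e5, e6, e7, e8⟩ k hk
    have hn0 : (0 : ℝ) < n := by exact_mod_cast (zero_lt_one.trans e1)
    have hkb : |(k : ℝ) * δ n| ≤ a n + δ n := (Finset.mem_filter.mp hk).2
    have hv : |F (ξ + k * δ n) - F ξ| ≤ d * (a n + δ n) := by
      have := hlip ξ (ξ + k * δ n) (by simpa using hρ) (by simpa using hkb.trans_lt e6)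
      rw [add_sub_cancel_left] at this
      exact this.trans (by gcongr)
    have hvL : 2 * (|F (ξ + k * δ n) - F ξ| * T) * s n ^ 2 ≤ Real.log n / 2 := by
      calc 2 * (|F (ξ + k * δ n) - F ξ| * T) * s n ^ 2
          ≤ 2 * (d * (a n + δ n) * T) * s n ^ 2 := by gcongr
        _ = 2 * (T * d) * (s n ^ 2 * (a n + δ n)) := by ring
        _ ≤ 2 * (T * d) * (1 / (4 * (T * d + 1)) * Real.log n) := by gcongr
        _ = (T * d) / (T * d + 1) * (Real.log n / 2) := by field_simp; ring
        _ ≤ Real.log n / 2 := mul_le_of_le_one_left (by positivity)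
          ((div_le_one (by positivity)).mpr (by linarith))
    have h := measureReal_deviation_le_of_fourth_root (K := K) (L := Real.log n)
      (t := 2 * C3 * (s n * Real.log n)) hX measurableSet_uIoc
      (fun i hi => measureReal_preimage_uIoc (hX i) (hF i hi) ξ (ξ + k * δ n)) hsum e2 (hs4 n) e5
      (by linarith) e3.le hvL (by
        have : 0 ≤ s n * Real.log n := by positivity
        nlinarith)
    refine h.trans_eq ?_
    rw [Real.exp_neg, mul_comm 3, Real.exp_mul, Real.exp_log hn0]
    norm_num
  have hsummable : Summable fun n => μ.real (⋃ k ∈ grid n, bad n k) := by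
    refine Summable.of_norm_bounded_eventually_nat (g := fun n : ℕ => 12 * ((n : ℝ) ^ 2)⁻¹)
      ((Real.summable_nat_pow_inv.mpr (by norm_num)).mul_left _) ?_
    filter_upwards [hbad_le, eventually_gt_atTop 0] with n hn hn1
    have hn0 : (1 : ℝ) ≤ n := by exact_mod_cast hn1
    have hcard : ((grid n).card : ℝ) ≤ 3 * n := by
      have h1 : (grid n).card ≤ 2 * n + 1 := by
        refine (Finset.card_filter_le _ _).trans ?_
        rw [Int.card_Icc]
        omega
      have h2 : ((grid n).card : ℝ) ≤ 2 * n + 1 := by exact_mod_cast h1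
      linarith
    rw [Real.norm_of_nonneg measureReal_nonneg]
    calc μ.real (⋃ k ∈ grid n, bad n k) ≤ ∑ k ∈ grid n, μ.real (bad n k) :=
          measureReal_biUnion_finset_le _ _
      _ ≤ (grid n).card • (4 * ((n : ℝ) ^ 3)⁻¹) := Finset.sum_le_card_nsmul _ _ _ hn
      _ = (grid n).card * (4 * ((n : ℝ) ^ 3)⁻¹) := nsmul_eq_mul _ _
      _ ≤ 3 * n * (4 * ((n : ℝ) ^ 3)⁻¹) := by gcongr
      _ = 12 * ((n : ℝ) ^ 2)⁻¹ := by field_simp; norm_num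
  have hBC : ∀ᵐ ω ∂μ, ∀ᶠ n in atTop, ω ∉ ⋃ k ∈ grid n, bad n k := by
    refine ae_eventually_notMem ?_
    simpa using hsummable.tsum_ofReal_ne_top
  filter_upwards [hBC] with ω hω
  filter_upwards [hω, hgood] with n hn ⟨e1, e2, e3, e4, e5, e6, e7, e8⟩
  have hn0 : (0 : ℝ) < n := by exact_mod_cast (zero_lt_one.trans e1)
  have hδ0 : 0 < δ n := by positivity
  have hrhs : (d + 4 * C3) * (n : ℝ) ^ (-(3 : ℝ) / 4) * Real.log n = d * δ n + 4 * C3 * δ n := by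
    rw [hδ]
    ring
  rw [hrhs]
  refine Real.sSup_le ?_ (by positivity)
  rintro _ ⟨x, hx, rfl⟩
  refine abs_sub_sub_le_of_grid (monotone_empDF n ω) hδ0 hd0.le (fun u w hu hw huw => ?_)
    (fun k hk => ?_) hx
  · have := hlip u w (hu.trans_lt e6) (hw.trans_lt e6)
    rw [abs_of_nonneg (sub_nonneg.mpr huw)] at this
    exact (le_abs_self _).trans this
  · have hkn : |(k : ℝ)| ≤ n := by
      have hle : a n + δ n ≤ n * δ n := by
        rw [hδs n e1]
        by_cases hneg : a n + δ n ≤ 0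
        · exact hneg.trans (by positivity)
        · have h1 : a n + δ n ≤ s n ^ 2 * (a n + δ n) :=
            le_mul_of_one_le_left (not_le.mp hneg).le (one_le_pow₀ e2)
          exact h1.trans (e7.trans (le_mul_of_one_le_left e3.le e2))
      rw [abs_mul, abs_of_pos hδ0] at hk
      exact le_of_mul_le_mul_right (hk.trans hle) hδ0
    have hkgrid : k ∈ grid n := by
      refine Finset.mem_filter.mpr ⟨Finset.mem_Icc.mpr ?_, hk⟩
      rw [← abs_le]
      exact_mod_cast hkn
    have hnot : ω ∉ bad n k := fun h => hn (mem_biUnion hkgrid h)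
    simp only [hbad, mem_ofPred_eq, not_le] at hnot
    rw [abs_sum_centredIndicator_uIoc hmono ξ _ (by omega), ← hδs n e1, hFξ] at hnot
    exact le_of_mul_le_mul_left (by linarith) hn0
end

section
/- Let {X_n, n≥1} be a φ-mixing sequence of random variables with Σ_{n=1}^∞ φ^{1/2}(n) < ∞. Fix p ∈ (0,1) and assume the common marginal distribution function F possesses a positive continuous density f in a neighborhood N_p of ξ_p such that 0 < d = sup{f(x) : x ∈ N_p} < ∞. For any θ > 0, put τ_n = ((16 C_3 + θ)^{1/2} (log n)^{3/2}) / (n^{1/2} (log log n)^{1/2}) and E_n = [ξ_p − τ_n, ξ_p + τ_n], where C_3 = 4[1 + 4 Σ_{n=1}^∞ φ^{1/2}(n)]. Then with probability 1, sup_{x ∈ E_n} |(F_n(x) − F(x)) − (F_n(ξ_p) − p)| ≤ (1 + d) ((16 C_3 + θ) log n / n)^{1/2} for all n sufficiently large. -/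
open MeasureTheory Filter Set

namespace PhiMixing

variable {Ω : Type*} {mΩ : MeasurableSpace Ω} {μ : Measure Ω} {X : ℕ → Ω → ℝ}

lemma measurable_sigmaGen {S : Set ℕ} {i : ℕ} (hi : i ∈ S) : Measurable[sigmaGen X S] (X i) :=
  Measurable.of_comap_le
    (le_iSup₂ (f := fun i (_ : i ∈ S) => MeasurableSpace.comap (X i) inferInstance) i hi)

lemma sigmaGen_le (hX : ∀ i, Measurable (X i)) (S : Set ℕ) : sigmaGen X S ≤ mΩ :=
  iSup₂_le fun i _ => (hX i).comap_le

lemma abs_condProb_sub_le_phiCoef [IsProbabilityMeasure μ] {n k : ℕ} (hk : 1 ≤ k) {A B : Set Ω}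
    (hA : MeasurableSet[sigmaGen X {i | 1 ≤ i ∧ i ≤ k}] A)
    (hB : MeasurableSet[sigmaGen X {i | k + n ≤ i}] B) (h0 : 0 < μ A) :
    |μ.real (A ∩ B) / μ.real A - μ.real B| ≤ phiCoef X μ n := by
  refine le_csSup ⟨1, ?_⟩ ⟨k, hk, A, B, hA, hB, h0, rfl⟩
  rintro r ⟨k, -, A, B, -, -, -, rfl⟩
  change |μ.real (A ∩ B) / μ.real A - μ.real B| ≤ 1
  have h1 : μ.real (A ∩ B) / μ.real A ≤ 1 :=
    div_le_one_of_le₀ (measureReal_mono inter_subset_left) measureReal_nonneg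
  have h2 : 0 ≤ μ.real (A ∩ B) / μ.real A := by positivity
  have h3 : μ.real B ≤ 1 := measureReal_le_one
  have h4 : 0 ≤ μ.real B := measureReal_nonneg
  rw [abs_le]
  constructor <;> linarith

lemma phiCoef_nonneg [IsProbabilityMeasure μ] (n : ℕ) : 0 ≤ phiCoef X μ n :=
  (abs_nonneg _).trans (abs_condProb_sub_le_phiCoef (μ := μ) (X := X) (n := n) (k := 1) le_rfl
    (A := univ) (B := univ) MeasurableSet.univ MeasurableSet.univ (by simp))

lemma measure_inter_le [IsProbabilityMeasure μ] {n k : ℕ} (hk : 1 ≤ k) {A B : Set Ω}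
    (hA : MeasurableSet[sigmaGen X {i | 1 ≤ i ∧ i ≤ k}] A)
    (hB : MeasurableSet[sigmaGen X {i | k + n ≤ i}] B) :
    μ (A ∩ B) ≤ ENNReal.ofReal (μ.real B + phiCoef X μ n) * μ A := by
  rcases eq_zero_or_pos (μ A) with h0 | h0
  · rw [measure_mono_null inter_subset_left h0]
    exact zero_le
  have hA0 : 0 < μ.real A := ENNReal.toReal_pos h0.ne' (measure_ne_top _ _)
  have h := (abs_le.1 (abs_condProb_sub_le_phiCoef (μ := μ) hk hA hB h0)).2
  rw [sub_le_iff_le_add', div_le_iff₀ hA0] at h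
  rw [← ofReal_measureReal, ← ofReal_measureReal (s := A), ← ENNReal.ofReal_mul
    (add_nonneg measureReal_nonneg (phiCoef_nonneg n))]
  exact ENNReal.ofReal_le_ofReal h

lemma setLIntegral_le [IsProbabilityMeasure μ] (hX : ∀ i, Measurable (X i)) {n k : ℕ}
    (hk : 1 ≤ k) {B : Set Ω} (hB : MeasurableSet[sigmaGen X {i | k + n ≤ i}] B)
    {W : Ω → ENNReal} (hW : Measurable[sigmaGen X {i | 1 ≤ i ∧ i ≤ k}] W) :
    ∫⁻ ω in B, W ω ∂μ ≤ ENNReal.ofReal (μ.real B + phiCoef X μ n) * ∫⁻ ω, W ω ∂μ := by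
  have hm := sigmaGen_le hX {i | 1 ≤ i ∧ i ≤ k}
  rw [← lintegral_trim hm hW, ← lintegral_trim (μ := μ) hm hW, ← smul_eq_mul,
    ← lintegral_smul_measure]
  refine lintegral_mono' (Measure.le_iff.2 fun A hA => ?_) le_rfl
  rw [trim_measurableSet_eq hm hA, Measure.restrict_apply (hm A hA), Measure.smul_apply,
    trim_measurableSet_eq hm hA, smul_eq_mul]
  exact measure_inter_le hk hA hB

/-- The number of indices `i ∈ T` with `X i ∈ S`, as a real random variable. -/
noncomputable def hits (X : ℕ → Ω → ℝ) (S : Set ℝ) (T : Finset ℕ) (ω : Ω) : ℝ :=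
  ∑ i ∈ T, S.indicator 1 (X i ω)

lemma lintegral_exp_hits_le [IsProbabilityMeasure μ] (hX : ∀ i, Measurable (X i)) {S : Set ℝ}
    (hS : MeasurableSet S) {π : ℝ} (hπ : ∀ i, 1 ≤ i → μ.real (X i ⁻¹' S) = π) {s : ℝ}
    (hs : 0 ≤ s) {q : ℕ} (T : Finset ℕ) (hT : ∀ i ∈ T, 1 ≤ i)
    (hsep : ∀ i ∈ T, ∀ j ∈ T, i < j → i + q ≤ j) :
    ∫⁻ ω, ENNReal.ofReal (Real.exp (s * hits X S T ω)) ∂μ ≤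
      ENNReal.ofReal (1 + (Real.exp s - 1) * (π + phiCoef X μ q)) ^ T.card := by
  have hs1 : 0 ≤ Real.exp s - 1 := by linarith [Real.add_one_le_exp s]
  have hφ := phiCoef_nonneg (μ := μ) (X := X) q
  have hπ0 : 0 ≤ π := hπ 1 le_rfl ▸ measureReal_nonneg
  induction T using Finset.induction_on_max with
  | empty => simp [hits]
  | insert a T ha ih =>
    have haT : a ∉ T := fun h => (ha a h).false
    have ih := ih (fun i hi => hT i (Finset.mem_insert_of_mem hi)) fun i hi j hj =>
      hsep i (Finset.mem_insert_of_mem hi) j (Finset.mem_insert_of_mem hj)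
    set W : Ω → ENNReal := fun ω => ENNReal.ofReal (Real.exp (s * hits X S T ω)) with hWdef
    have ha1 : 1 ≤ a := hT a (Finset.mem_insert_self a T)
    have hWm : ∀ m : MeasurableSpace Ω, (∀ i ∈ T, Measurable[m] (X i)) → Measurable[m] W := by
      intro m hm
      refine ENNReal.measurable_ofReal.comp (Real.measurable_exp.comp (Measurable.const_mul ?_ s))
      exact Finset.measurable_fun_sum _ fun i hi =>
        ((measurable_one.indicator hS).comp (hm i hi))
    have hkey : ∫⁻ ω in X a ⁻¹' S, W ω ∂μ ≤
        ENNReal.ofReal (π + phiCoef X μ q) * ∫⁻ ω, W ω ∂μ := by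
      rcases T.eq_empty_or_nonempty with rfl | ⟨b, hb⟩
      · simp only [hWdef, hits, Finset.sum_empty, mul_zero, Real.exp_zero, ENNReal.ofReal_one,
          lintegral_one, Measure.restrict_apply_univ, measure_univ, mul_one]
        rw [← ofReal_measureReal, hπ a ha1]
        exact ENNReal.ofReal_le_ofReal (by linarith)
      · have hle : ∀ i ∈ T, i + q ≤ a := fun i hi =>
          hsep i (Finset.mem_insert_of_mem hi) a (Finset.mem_insert_self a T) (ha i hi)
        have hT1 : ∀ i ∈ T, 1 ≤ i := fun i hi => hT i (Finset.mem_insert_of_mem hi)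
        rw [← hπ a ha1]
        refine setLIntegral_le (k := a - q) hX ?_ ?_ ?_
        · have := hle b hb; have := hT1 b hb; omega
        · exact measurable_sigmaGen (by have := hle b hb; simp only [mem_ofPred_eq]; omega) hS
        · refine hWm _ fun i hi => measurable_sigmaGen ?_
          have := hle i hi; have := hT1 i hi
          simp only [mem_ofPred_eq]; omega
    have hB : MeasurableSet (X a ⁻¹' S) := hX a hS
    have hWmeas : Measurable W := hWm _ fun i _ => hX i
    have hsplit : ∀ ω, ENNReal.ofReal (Real.exp (s * hits X S (insert a T) ω)) =
        W ω + ENNReal.ofReal (Real.exp s - 1) * (X a ⁻¹' S).indicator W ω := by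
      intro ω
      simp only [hWdef, hits, Finset.sum_insert haT]
      by_cases h : X a ω ∈ S
      · rw [indicator_of_mem h, indicator_of_mem (show ω ∈ X a ⁻¹' S from h), mul_add,
          Real.exp_add, ← ENNReal.ofReal_mul hs1, ← ENNReal.ofReal_add (by positivity)
          (mul_nonneg hs1 (by positivity))]
        congr 1
        simp
        ring
      · rw [indicator_of_notMem h, indicator_of_notMem (show ω ∉ X a ⁻¹' S from h)]
        simp
    simp_rw [hsplit]
    rw [lintegral_add_left hWmeas, lintegral_const_mul _ (hWmeas.indicator hB),
      lintegral_indicator hB, Finset.card_insert_of_notMem haT, pow_succ']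
    calc ∫⁻ ω, W ω ∂μ + ENNReal.ofReal (Real.exp s - 1) * ∫⁻ ω in X a ⁻¹' S, W ω ∂μ
        ≤ ∫⁻ ω, W ω ∂μ + ENNReal.ofReal (Real.exp s - 1) *
          (ENNReal.ofReal (π + phiCoef X μ q) * ∫⁻ ω, W ω ∂μ) := by gcongr
      _ = ENNReal.ofReal (1 + (Real.exp s - 1) * (π + phiCoef X μ q)) * ∫⁻ ω, W ω ∂μ := by
        rw [ENNReal.ofReal_add zero_le_one (by positivity), ENNReal.ofReal_mul hs1,
          ENNReal.ofReal_one]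
        ring
      _ ≤ _ := by gcongr

lemma measure_le_hits_le [IsProbabilityMeasure μ] (hX : ∀ i, Measurable (X i)) {S : Set ℝ}
    (hS : MeasurableSet S) {π : ℝ} (hπ : ∀ i, 1 ≤ i → μ.real (X i ⁻¹' S) = π) {s : ℝ}
    (hs : 0 ≤ s) {q : ℕ} (T : Finset ℕ) (hT : ∀ i ∈ T, 1 ≤ i)
    (hsep : ∀ i ∈ T, ∀ j ∈ T, i < j → i + q ≤ j) {b : ℝ}
    (hb : 1 + (Real.exp s - 1) * (π + phiCoef X μ q) ≤ Real.exp b) (c : ℝ) :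
    μ {ω | c ≤ hits X S T ω} ≤ ENNReal.ofReal (Real.exp (T.card * b - s * c)) := by
  have hmono : {ω | c ≤ hits X S T ω} ⊆
      {ω | ENNReal.ofReal (Real.exp (s * c)) ≤ ENNReal.ofReal (Real.exp (s * hits X S T ω))} :=
    fun ω hω => ENNReal.ofReal_le_ofReal
      (Real.exp_le_exp.2 (mul_le_mul_of_nonneg_left hω hs))
  have hmeas : Measurable fun ω => ENNReal.ofReal (Real.exp (s * hits X S T ω)) :=
    ENNReal.measurable_ofReal.comp (Real.measurable_exp.comp (Measurable.const_mul
      (Finset.measurable_fun_sum _ fun i _ => (measurable_one.indicator hS).comp (hX i)) s))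
  refine (measure_mono hmono).trans ((meas_ge_le_lintegral_div hmeas.aemeasurable
    (by simp [Real.exp_pos]) ENNReal.ofReal_ne_top).trans ?_)
  rw [Real.exp_sub, ENNReal.ofReal_div_of_pos (Real.exp_pos _)]
  gcongr
  refine (lintegral_exp_hits_le hX hS hπ hs T hT hsep).trans ?_
  rw [Real.exp_nat_mul, ENNReal.ofReal_pow (Real.exp_pos _).le]
  gcongr

/-- Chernoff-type deviation bound for indicators along `q`-separated indices. -/
lemma measure_le_abs_hits_sub_le [IsProbabilityMeasure μ] (hX : ∀ i, Measurable (X i))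
    {S : Set ℝ} (hS : MeasurableSet S) {π : ℝ} (hπ : ∀ i, 1 ≤ i → μ.real (X i ⁻¹' S) = π) {s : ℝ}
    (hs : 0 ≤ s) (hs1 : s ≤ 1) {q : ℕ} (T : Finset ℕ) (hT : ∀ i ∈ T, 1 ≤ i)
    (hsep : ∀ i ∈ T, ∀ j ∈ T, i < j → i + q ≤ j) (a : ℝ) :
    μ {ω | a ≤ |hits X S T ω - T.card * π|} ≤
      2 * ENNReal.ofReal (Real.exp (T.card * (s ^ 2 * π + 2 * phiCoef X μ q) - s * a)) := by
  have hφ := phiCoef_nonneg (μ := μ) (X := X) q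
  have hπ0 : 0 ≤ π := hπ 1 le_rfl ▸ measureReal_nonneg
  have hπc : ∀ i, 1 ≤ i → μ.real (X i ⁻¹' Sᶜ) = 1 - π := fun i hi => by
    rw [preimage_compl, probReal_compl_eq_one_sub (hX i hS), hπ i hi]
  have he1 := (abs_le.1 (Real.abs_exp_sub_one_sub_id_le (x := s) (by rwa [abs_of_nonneg hs]))).2
  have he2 := (abs_le.1 (Real.abs_exp_sub_one_sub_id_le (x := -s)
    (by rwa [abs_neg, abs_of_nonneg hs]))).2
  have hup := measure_le_hits_le (μ := μ) hX hS hπ hs (q := q) T hT hsep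
    (b := s * π + (s ^ 2 * π + 2 * phiCoef X μ q)) (by
      refine (add_comm _ _).trans_le ((Real.add_one_le_exp _).trans (Real.exp_le_exp.2 ?_))
      nlinarith [mul_le_mul_of_nonneg_right he1 hπ0, mul_le_mul_of_nonneg_right he1 hφ,
        mul_nonneg (sub_nonneg.2 hs1) hφ, mul_nonneg hs (mul_nonneg (sub_nonneg.2 hs1) hφ)])
    (T.card * π + a)
  have hlow := measure_le_hits_le (μ := μ) hX hS.compl hπc hs (q := q) T hT hsep
    (b := s * (1 - π) + (s ^ 2 * π + 2 * phiCoef X μ q)) (by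
      have h1 : 1 + (Real.exp s - 1) * (1 - π + phiCoef X μ q) =
          Real.exp s * ((Real.exp (-s) - 1) * (π - phiCoef X μ q) + 1) := by
        have : Real.exp s * Real.exp (-s) = 1 := by rw [← Real.exp_add]; simp
        linear_combination (-(π - phiCoef X μ q)) * this
      rw [h1, show s * (1 - π) + (s ^ 2 * π + 2 * phiCoef X μ q) =
        s + (-s * π + s ^ 2 * π + 2 * phiCoef X μ q) by ring, Real.exp_add s]
      refine mul_le_mul_of_nonneg_left ((Real.add_one_le_exp _).trans
        (Real.exp_le_exp.2 ?_)) (Real.exp_pos _).le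
      nlinarith [mul_le_mul_of_nonneg_right he2 hπ0, mul_nonneg (Real.exp_pos (-s)).le hφ])
    (T.card * (1 - π) + a)
  have hcompl : ∀ ω, hits X Sᶜ T ω = T.card - hits X S T ω := by
    intro ω
    have h : ∀ x, Sᶜ.indicator (1 : ℝ → ℝ) x = 1 - S.indicator 1 x := fun x => by
      by_cases hx : x ∈ S <;> simp [hx]
    simp [hits, h]
  have hsub : {ω | a ≤ |hits X S T ω - T.card * π|} ⊆
      {ω | T.card * π + a ≤ hits X S T ω} ∪ {ω | T.card * (1 - π) + a ≤ hits X Sᶜ T ω} := by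
    intro ω hω
    rcases le_abs.1 (show a ≤ |_| from hω) with h | h
    · left
      simp only [mem_ofPred_eq]
      linarith
    · right
      simp only [mem_ofPred_eq, hcompl]
      linarith
  refine (measure_mono hsub).trans ((measure_union_le _ _).trans ?_)
  rw [two_mul]
  refine add_le_add (hup.trans_eq ?_) (hlow.trans_eq ?_) <;> congr 2 <;> ring

/-- Splitting `{1, …, n}` into residue classes modulo `q` gives a deviation bound for the number
of visits to `S` up to time `n`. -/
lemma measure_lt_abs_hits_Icc_sub_le [IsProbabilityMeasure μ] (hX : ∀ i, Measurable (X i))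
    {S : Set ℝ} (hS : MeasurableSet S) {π : ℝ} (hπ : ∀ i, 1 ≤ i → μ.real (X i ⁻¹' S) = π) {s : ℝ}
    (hs : 0 ≤ s) (hs1 : s ≤ 1) {q : ℕ} (hq : 1 ≤ q) (n : ℕ) (a : ℝ) :
    μ {ω | a < |hits X S (Finset.Icc 1 n) ω - n * π|} ≤
      q * (2 * ENNReal.ofReal (Real.exp
        ((n / q + 1) * (s ^ 2 * π + 2 * phiCoef X μ q) - s * (a / q)))) := by
  have hφ := phiCoef_nonneg (μ := μ) (X := X) q
  have hπ0 : 0 ≤ π := hπ 1 le_rfl ▸ measureReal_nonneg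
  have hq0 : (0 : ℝ) < q := by exact_mod_cast hq
  let T : ℕ → Finset ℕ := fun r => {i ∈ Finset.Icc 1 n | i % q = r}
  have hmaps : ∀ i ∈ Finset.Icc 1 n, i % q ∈ Finset.range q := fun i _ =>
    Finset.mem_range.2 (Nat.mod_lt _ hq)
  have hcard : ∀ r, ((T r).card : ℝ) ≤ n / q + 1 := by
    intro r
    have h : (T r).card ≤ n / q + 1 := by
      rw [← Finset.card_range (n / q + 1)]
      refine Finset.card_le_card_of_injOn (· / q) ?_ ?_
      · intro i hi
        simp only [T, Finset.coe_filter, Finset.mem_Icc, mem_ofPred_eq] at hi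
        simpa [Nat.lt_succ_iff] using Nat.div_le_div_right hi.1.2
      · intro i hi j hj hij
        simp only [T, Finset.coe_filter, Finset.mem_Icc, mem_ofPred_eq] at hi hj
        rw [← Nat.div_add_mod i q, ← Nat.div_add_mod j q, hi.2, hj.2]
        simp only at hij
        rw [hij]
    calc ((T r).card : ℝ) ≤ ((n / q + 1 : ℕ) : ℝ) := by exact_mod_cast h
      _ ≤ n / q + 1 := by push_cast; gcongr; exact Nat.cast_div_le
  have hdecomp : ∀ ω, hits X S (Finset.Icc 1 n) ω - n * π =
      ∑ r ∈ Finset.range q, (hits X S (T r) ω - (T r).card * π) := by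
    intro ω
    have h1 : ∑ r ∈ Finset.range q, hits X S (T r) ω = hits X S (Finset.Icc 1 n) ω :=
      Finset.sum_fiberwise_of_maps_to hmaps _
    have h2 : ∑ r ∈ Finset.range q, (T r).card = n := by
      simpa using (Finset.card_eq_sum_card_fiberwise hmaps).symm
    rw [Finset.sum_sub_distrib, h1, ← Finset.sum_mul, ← Nat.cast_sum, h2]
  have hsub : {ω | a < |hits X S (Finset.Icc 1 n) ω - n * π|} ⊆
      ⋃ r ∈ Finset.range q, {ω | a / q ≤ |hits X S (T r) ω - (T r).card * π|} := by
    intro ω hω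
    by_contra hcon
    simp only [mem_iUnion, mem_ofPred_eq, not_exists, not_le] at hcon
    have : |hits X S (Finset.Icc 1 n) ω - n * π| ≤ a := by
      rw [hdecomp]
      refine (Finset.abs_sum_le_sum_abs _ _).trans
        ((Finset.sum_le_sum fun r hr => (hcon r hr).le).trans_eq ?_)
      rw [Finset.sum_const, Finset.card_range, nsmul_eq_mul]
      field_simp
    exact (not_lt.2 this) hω
  refine (measure_mono hsub).trans ((measure_biUnion_finset_le _ _).trans
    ((Finset.sum_le_card_nsmul _ _ (2 * ENNReal.ofReal (Real.exp
      ((n / q + 1) * (s ^ 2 * π + 2 * phiCoef X μ q) - s * (a / q)))) fun r _ => ?_).trans_eq ?_))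
  · refine (measure_le_abs_hits_sub_le (μ := μ) hX hS hπ hs hs1 (q := q) (T r) ?_ ?_ _).trans ?_
    · intro i hi
      simp only [T, Finset.mem_filter, Finset.mem_Icc] at hi
      exact hi.1.1
    · intro i hi j hj hij
      simp only [T, Finset.mem_filter] at hi hj
      have hd : q ∣ j - i := (Nat.modEq_iff_dvd' hij.le).1 (hi.2.trans hj.2.symm)
      have := Nat.le_of_dvd (Nat.sub_pos_of_lt hij) hd
      omega
    · gcongr
      exact hcard r
  · simp

lemma sq_mul_phiCoef_le [IsProbabilityMeasure μ] (hanti : Antitone (phiCoef X μ))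
    (hsum : Summable fun n : ℕ => Real.sqrt (phiCoef X μ (n + 1))) (q : ℕ) :
    (q : ℝ) ^ 2 * phiCoef X μ q ≤ (∑' n : ℕ, Real.sqrt (phiCoef X μ (n + 1))) ^ 2 := by
  have h : (q : ℝ) * Real.sqrt (phiCoef X μ q) ≤ ∑' n : ℕ, Real.sqrt (phiCoef X μ (n + 1)) := by
    refine le_trans ?_ (hsum.sum_le_tsum (Finset.range q) fun _ _ => Real.sqrt_nonneg _)
    simpa using Finset.card_nsmul_le_sum (Finset.range q) _ (Real.sqrt (phiCoef X μ q))
      fun n hn => Real.sqrt_le_sqrt (hanti (Nat.succ_le_of_lt (Finset.mem_range.1 hn)))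
  calc (q : ℝ) ^ 2 * phiCoef X μ q = (q * Real.sqrt (phiCoef X μ q)) ^ 2 := by
        rw [mul_pow, Real.sq_sqrt (phiCoef_nonneg q)]
    _ ≤ _ := pow_le_pow_left₀ (by positivity) h 2

lemma apply_quantile_of_continuousAt {F : ℝ → ℝ} (hmono : Monotone F)
    (hbot : Tendsto F atBot (nhds 0)) (htop : Tendsto F atTop (nhds 1)) {p : ℝ} (hp0 : 0 < p)
    (hp1 : p < 1) (hc : ContinuousAt F (quantile F p)) : F (quantile F p) = p := by
  have hne : {x : ℝ | p ≤ F x}.Nonempty := ((htop.eventually_const_lt hp1).exists).imp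
    fun x hx => hx.le
  have hbdd : BddBelow {x : ℝ | p ≤ F x} := by
    obtain ⟨y, hy⟩ := (hbot.eventually_lt_const hp0).exists
    exact ⟨y, fun x hx => (hmono.reflect_lt (hy.trans_le hx)).le⟩
  refine le_antisymm ?_ ?_
  · refine le_of_tendsto (hc.tendsto.mono_left nhdsWithin_le_nhds : Tendsto F
      (nhdsWithin _ (Iio (quantile F p))) _) (eventually_mem_nhdsWithin.mono fun x hx => ?_)
    exact (not_le.1 fun h => (not_lt.2 (csInf_le hbdd h)) hx).le
  · refine ge_of_tendsto (hc.tendsto.mono_left nhdsWithin_le_nhds : Tendsto F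
      (nhdsWithin _ (Ioi (quantile F p))) _) (eventually_mem_nhdsWithin.mono fun x hx => ?_)
    obtain ⟨y, hy, hyx⟩ := exists_lt_of_csInf_lt hne hx
    exact le_trans hy (hmono hyx.le)

/-- A bound for `G - H` on a grid of mesh `L` extends to the whole interval when `G` is monotone
and `H` is Lipschitz. -/
lemma abs_sub_le_of_grid {G H : ℝ → ℝ} (hG : Monotone G) {ξ L d : ℝ} {J : ℕ} (hL : 0 < L)
    (hd : 0 ≤ d)
    (hgrid : ∀ j ∈ Finset.Icc (-J : ℤ) J, |G (ξ + j * L) - H (ξ + j * L)| ≤ L)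
    (hH : ∀ x y, |x - ξ| ≤ J * L → |y - ξ| ≤ J * L → |H x - H y| ≤ d * |x - y|) {x : ℝ}
    (hx : |x - ξ| ≤ (J - 1) * L) : |G x - H x| ≤ (1 + d) * L := by
  set j : ℤ := ⌊(x - ξ) / L⌋ with hj
  have hj1 : j * L ≤ x - ξ := (le_div_iff₀ hL).1 (Int.floor_le _)
  have hj2 : x - ξ < (j + 1) * L := (div_lt_iff₀ hL).1 (Int.lt_floor_add_one _)
  obtain ⟨hxl, hxu⟩ := abs_le.1 hx
  have hjl : -(J : ℤ) ≤ j := by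
    have : (-(J : ℝ)) < (j + 1 : ℝ) := lt_of_mul_lt_mul_right (by linarith) hL.le
    have : -(J : ℤ) < j + 1 := by exact_mod_cast this
    omega
  have hju : j + 1 ≤ (J : ℤ) := by
    have : (j : ℝ) ≤ (J - 1 : ℝ) := le_of_mul_le_mul_right (by linarith) hL
    have : (j : ℤ) ≤ J - 1 := by exact_mod_cast this
    omega
  have hball : ∀ i : ℤ, -(J : ℤ) ≤ i → i ≤ J → |ξ + i * L - ξ| ≤ J * L := by
    intro i h1 h2
    have h1 : -(J : ℝ) ≤ i := by exact_mod_cast h1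
    have h2 : (i : ℝ) ≤ J := by exact_mod_cast h2
    rw [add_sub_cancel_left, abs_mul, abs_of_pos hL]
    exact mul_le_mul_of_nonneg_right (abs_le.2 ⟨h1, h2⟩) hL.le
  have hxb : |x - ξ| ≤ J * L := hx.trans (by nlinarith)
  have g1 := abs_le.1 (hgrid j (Finset.mem_Icc.2 ⟨hjl, by omega⟩))
  have g2 := abs_le.1 (hgrid (j + 1) (Finset.mem_Icc.2 ⟨by omega, hju⟩))
  have m1 : G (ξ + j * L) ≤ G x := hG (by linarith)
  have m2 : G x ≤ G (ξ + (j + 1 : ℤ) * L) := hG (by push_cast; linarith)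
  have l1 := (abs_le.1 (hH x _ hxb (hball j hjl (by omega)))).2
  have l2 := (abs_le.1 (hH _ x (hball (j + 1) (by omega) hju) hxb)).2
  rw [abs_of_nonneg (by linarith)] at l1
  rw [abs_of_nonneg (by push_cast; linarith)] at l2
  have e1 : d * (x - (ξ + j * L)) ≤ d * L := mul_le_mul_of_nonneg_left (by linarith) hd
  have e2 : d * (ξ + (j + 1 : ℤ) * L - x) ≤ d * L :=
    mul_le_mul_of_nonneg_left (by push_cast; linarith) hd
  rw [abs_le]
  constructor <;> linarith

lemma eventually_mul_log_sq_le_exp (C : ℝ) :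
    ∀ᶠ n : ℕ in atTop, C * Real.log n ^ 2 ≤ Real.exp (Real.log n / 12) := by
  have h := ((Real.tendsto_exp_div_pow_atTop 2).comp
    ((Real.tendsto_log_atTop.comp tendsto_natCast_atTop_atTop).atTop_div_const
      (by norm_num : (0 : ℝ) < 12))).eventually_ge_atTop (C * 144)
  filter_upwards [h, (Real.tendsto_log_atTop.comp
    tendsto_natCast_atTop_atTop).eventually_ge_atTop 1] with n hn h1
  simp only [Function.comp_apply] at hn h1
  rw [le_div_iff₀ (by positivity)] at hn
  linarith

lemma natCast_eq_exp_log_div_pow {n : ℕ} (hn : 1 ≤ n) :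
    (n : ℝ) = Real.exp (Real.log n / 12) ^ 12 := by
  have hn0 : (0 : ℝ) < n := by exact_mod_cast hn
  rw [← Real.exp_nat_mul, show ((12 : ℕ) : ℝ) * (Real.log n / 12) = Real.log n by
    push_cast; ring, Real.exp_log hn0]

lemma sqrt_mul_log_div_eq {K : ℝ} (hK : 0 ≤ K) {n : ℕ} (hn : 1 ≤ n) :
    Real.sqrt (K * Real.log n / n) =
      Real.sqrt (K * Real.log n) / Real.exp (Real.log n / 12) ^ 6 := by
  rw [Real.sqrt_div (mul_nonneg hK (Real.log_natCast_nonneg n))]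
  congr 1
  rw [Real.sqrt_eq_iff_mul_self_eq (by positivity) (by positivity), ← pow_add]
  exact natCast_eq_exp_log_div_pow hn

/-- Block length `q` and Chernoff parameter `s` for which the deviation bounds along the grid
are summable in `n`. -/
lemma eventually_exists_block_bound {K d D : ℝ} (hK : 1 ≤ K) (hd : 0 ≤ d) (hD : 0 ≤ D) :
    ∀ᶠ n : ℕ in atTop, ∃ q : ℕ, 1 ≤ q ∧ ∃ s : ℝ, 0 ≤ s ∧ s ≤ 1 ∧ ∀ π φ : ℝ, 0 ≤ π → 0 ≤ φ →
      π ≤ d * ((Real.log n + 2) * Real.sqrt (K * Real.log n / n)) → (q : ℝ) ^ 2 * φ ≤ D →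
      (2 * Real.log n + 5) * (q * (2 * Real.exp ((n / q + 1) * (s ^ 2 * π + 2 * φ) -
        s * (n * Real.sqrt (K * Real.log n / n) / q)))) ≤ 1 / (n : ℝ) ^ 2 := by
  filter_upwards [eventually_mul_log_sq_le_exp (2 * (6 * d * K + 4 * D + 4)),
    (Real.tendsto_log_atTop.comp tendsto_natCast_atTop_atTop).eventually_ge_atTop 20,
    eventually_ge_atTop 1] with n hexp hy hn
  simp only [Function.comp_apply] at hy
  rw [sqrt_mul_log_div_eq (by linarith) hn]
  have hn0 : (0 : ℝ) < n := by exact_mod_cast hn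
  set y := Real.log n with hydef
  set z := Real.exp (y / 12) with hz
  set w := Real.sqrt (K * y) with hw
  have hz1 : 1 ≤ z := Real.one_le_exp (by linarith)
  have hz0 : 0 < z := by linarith
  have hnz : (n : ℝ) = z ^ 12 := natCast_eq_exp_log_div_pow hn
  have hKy : 1 ≤ K * y := by nlinarith
  have hw1 : 1 ≤ w := Real.one_le_sqrt.2 hKy
  have hwK : w ≤ K * y := Real.sqrt_le_iff.2 ⟨by linarith, by nlinarith⟩
  have hz4 : 1 ≤ z ^ 4 := one_le_pow₀ hz1
  set q := ⌈z ^ 4⌉₊ with hq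
  have hq1 : z ^ 4 ≤ q := Nat.le_ceil _
  have hq2 : (q : ℝ) ≤ 2 * z ^ 4 := by linarith [Nat.ceil_lt_add_one (by positivity : 0 ≤ z ^ 4)]
  have hq0 : (0 : ℝ) < q := by linarith
  refine ⟨q, by exact_mod_cast hq0, z⁻¹, by positivity, inv_le_one_of_one_le₀ hz1, ?_⟩
  intro π φ hπ0 hφ0 hπ hφ
  have hgain : z / 2 ≤ z⁻¹ * (n * (w / z ^ 6) / q) := by
    have h : z⁻¹ * (n * (w / z ^ 6) / q) = z ^ 5 * w / q := by
      rw [hnz]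
      field_simp
    rw [h, le_div_iff₀ hq0]
    calc z / 2 * q ≤ z / 2 * (2 * z ^ 4) := by gcongr
      _ = z ^ 5 * 1 := by ring
      _ ≤ z ^ 5 * w := by gcongr
  have hblocks : n / q + 1 ≤ 2 * z ^ 8 := by
    have h1 : (n : ℝ) / q ≤ z ^ 8 := by
      rw [div_le_iff₀ hq0, hnz]
      calc z ^ 12 = z ^ 8 * z ^ 4 := by ring
        _ ≤ _ := by gcongr
    linarith [one_le_pow₀ (n := 8) hz1]
  have hcost : (n / q + 1) * (z⁻¹ ^ 2 * π + 2 * φ) ≤ 2 * d * ((y + 2) * (K * y)) + 4 * D := by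
    calc (n / q + 1) * (z⁻¹ ^ 2 * π + 2 * φ)
        ≤ 2 * z ^ 8 * (z⁻¹ ^ 2 * π + 2 * φ) := by gcongr
      _ = 2 * z ^ 6 * π + 4 * ((z ^ 4) ^ 2 * φ) := by field_simp; ring
      _ ≤ 2 * z ^ 6 * (d * ((y + 2) * (w / z ^ 6))) + 4 * (q ^ 2 * φ) := by gcongr
      _ = 2 * d * ((y + 2) * w) + 4 * (q ^ 2 * φ) := by field_simp
      _ ≤ _ := by gcongr
  have hy2 : y ≤ y ^ 2 := by nlinarith
  have hmain : (n / q + 1) * (z⁻¹ ^ 2 * π + 2 * φ) - z⁻¹ * (n * (w / z ^ 6) / q) ≤ -(4 * y) := by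
    have h1 : 2 * d * ((y + 2) * (K * y)) ≤ 6 * d * K * y ^ 2 := by
      have : 0 ≤ d * K := by positivity
      nlinarith
    have h2 : 4 * D ≤ 4 * D * y ^ 2 := by nlinarith
    linarith
  have hpre : 2 * y + 5 ≤ Real.exp y / 4 := by
    nlinarith [Real.quadratic_le_exp_of_nonneg (show 0 ≤ y by linarith)]
  have hn_exp : Real.exp y = n := Real.exp_log hn0
  have hqn : (q : ℝ) ≤ 2 * n := by
    refine hq2.trans ?_
    rw [hnz]
    gcongr
    · norm_num
  calc (2 * y + 5) * (q * (2 * Real.exp ((n / q + 1) * (z⁻¹ ^ 2 * π + 2 * φ) -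
        z⁻¹ * (n * (w / z ^ 6) / q))))
      ≤ Real.exp y / 4 * (2 * n * (2 * Real.exp (-(4 * y)))) := by gcongr
    _ = 1 / (n : ℝ) ^ 2 := by
      rw [Real.exp_neg, show 4 * y = (4 : ℕ) * y by norm_num, Real.exp_nat_mul, hn_exp]
      field_simp
      norm_num

lemma empDF_mono (n : ℕ) (ω : Ω) : Monotone (empDF X n ω) := fun x y hxy => by
  refine mul_le_mul_of_nonneg_left (Finset.sum_le_sum fun i _ => ?_) (by positivity)
  by_cases h : X i ω ≤ x
  · simp [h, h.trans hxy]
  · simp only [h, if_false]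
    split_ifs <;> simp

lemma empDF_sub_empDF (n : ℕ) (ω : Ω) {a b : ℝ} (hab : a ≤ b) :
    empDF X n ω b - empDF X n ω a = (n : ℝ)⁻¹ * hits X (Ioc a b) (Finset.Icc 1 n) ω := by
  simp only [empDF, hits]
  rw [← mul_sub, ← Finset.sum_sub_distrib]
  congr 1
  refine Finset.sum_congr rfl fun i _ => ?_
  by_cases h1 : X i ω ≤ a
  · simp [h1, h1.trans hab]
  · by_cases h2 : X i ω ≤ b <;> simp [h1, h2, indicator, not_le.1 h1]

/-- Deviation bound for increments of the empirical process. -/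
lemma measure_lt_abs_empDF_increment_le [IsProbabilityMeasure μ] (hX : ∀ i, Measurable (X i))
    {F : ℝ → ℝ} (hF : ∀ i, 1 ≤ i → ∀ x, F x = μ.real {ω | X i ω ≤ x}) {s : ℝ}
    (hs : 0 ≤ s) (hs1 : s ≤ 1) {q : ℕ} (hq : 1 ≤ q) {n : ℕ} (hn : 1 ≤ n) (L a b : ℝ) :
    μ {ω | L < |(empDF X n ω b - empDF X n ω a) - (F b - F a)|} ≤
      q * (2 * ENNReal.ofReal (Real.exp
        ((n / q + 1) * (s ^ 2 * |F b - F a| + 2 * phiCoef X μ q) - s * (n * L / q)))) := by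
  wlog hab : a ≤ b generalizing a b
  · have h := this b a (le_of_not_ge hab)
    rw [abs_sub_comm (F a)] at h
    convert h using 5 with ω
    rw [← abs_neg]
    congr 1
    ring
  have hn0 : (0 : ℝ) < n := by exact_mod_cast hn
  have hπ : ∀ i, 1 ≤ i → μ.real (X i ⁻¹' Ioc a b) = |F b - F a| := by
    intro i hi
    have hle : F a ≤ F b := by
      rw [hF i hi, hF i hi]
      exact measureReal_mono fun ω (hω : X i ω ≤ a) => hω.trans hab
    rw [abs_of_nonneg (sub_nonneg.2 hle), hF i hi, hF i hi, ← measureReal_sdiff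
      (μ := μ) (s₁ := {ω | X i ω ≤ b}) (s₂ := {ω | X i ω ≤ a})
      (fun ω (hω : X i ω ≤ a) => hω.trans hab) (measurableSet_le (hX i) measurable_const)]
    congr 1
    ext ω
    simp [and_comm]
  have hle : 0 ≤ F b - F a := by
    rw [hF 1 le_rfl, hF 1 le_rfl, sub_nonneg]
    exact measureReal_mono fun ω (hω : X 1 ω ≤ a) => hω.trans hab
  refine le_trans (measure_mono fun ω hω => ?_)
    (measure_lt_abs_hits_Icc_sub_le hX measurableSet_Ioc hπ hs hs1 hq n (n * L))
  simp only [mem_ofPred_eq] at hω ⊢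
  rwa [empDF_sub_empDF n ω hab, ← inv_mul_cancel_left₀ hn0.ne' (F b - F a), ← mul_sub, abs_mul,
    abs_of_pos (inv_pos.2 hn0), lt_inv_mul_iff₀ hn0, ← abs_of_nonneg hle] at hω

lemma ae_eventually_notMem_of_eventually_measure_le {B : ℕ → Set Ω}
    (h : ∀ᶠ n : ℕ in atTop, μ (B n) ≤ ENNReal.ofReal (1 / (n : ℝ) ^ 2)) :
    ∀ᵐ ω ∂μ, ∀ᶠ n in atTop, ω ∉ B n := by
  obtain ⟨N, hN⟩ := eventually_atTop.1 h
  have hfin : ∑' n, μ (B (n + N)) ≠ ⊤ := by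
    have hs : Summable fun n : ℕ => 1 / ((n + N : ℕ) : ℝ) ^ 2 :=
      (summable_nat_add_iff N).2 (Real.summable_one_div_nat_pow.2 one_lt_two)
    exact ((ENNReal.tsum_le_tsum fun n => hN (n + N) (Nat.le_add_left N n)).trans_lt
      hs.tsum_ofReal_lt_top).ne
  filter_upwards [ae_eventually_notMem hfin] with ω hω
  obtain ⟨M, hM⟩ := eventually_atTop.1 hω
  filter_upwards [eventually_ge_atTop (M + N)] with n hn
  have := hM (n - N) (by omega)
  rwa [Nat.sub_add_cancel (by omega)] at this

/-- Almost surely, the increments of the empirical process at the points of a grid of mesh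
`√(K log n / n)` around `ξ` are eventually bounded by that mesh. -/
lemma ae_eventually_grid_le [IsProbabilityMeasure μ] (hX : ∀ i, Measurable (X i))
    (hanti : Antitone (phiCoef X μ))
    (hsum : Summable fun n : ℕ => Real.sqrt (phiCoef X μ (n + 1)))
    {F : ℝ → ℝ} (hF : ∀ i, 1 ≤ i → ∀ x, F x = μ.real {ω | X i ω ≤ x}) {ξ d ε K : ℝ} (hd : 0 ≤ d)
    (hε : 0 < ε) (hK : 1 ≤ K) (hLip : ∀ x, |x - ξ| ≤ ε → |F x - F ξ| ≤ d * |x - ξ|) :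
    (∀ᶠ n : ℕ in atTop, (Real.log n + 2) * Real.sqrt (K * Real.log n / n) ≤ ε) ∧
    ∀ᵐ ω ∂μ, ∀ᶠ n : ℕ in atTop, ∀ j ∈ Finset.Icc (-(⌈Real.log n⌉₊ + 1 : ℕ) : ℤ)
      (⌈Real.log n⌉₊ + 1 : ℕ),
      |(empDF X n ω (ξ + j * Real.sqrt (K * Real.log n / n)) - empDF X n ω ξ) -
        (F (ξ + j * Real.sqrt (K * Real.log n / n)) - F ξ)| ≤ Real.sqrt (K * Real.log n / n) := by
  have hsmall : ∀ᶠ n : ℕ in atTop, (Real.log n + 2) * Real.sqrt (K * Real.log n / n) ≤ ε := by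
    filter_upwards [eventually_mul_log_sq_le_exp (3 * K / ε), eventually_ge_atTop 1,
      (Real.tendsto_log_atTop.comp tendsto_natCast_atTop_atTop).eventually_ge_atTop 1]
      with n h hn hy
    simp only [Function.comp_apply] at hy
    rw [sqrt_mul_log_div_eq (by linarith) hn, ← mul_div_assoc]
    set y := Real.log n
    have hz1 : 1 ≤ Real.exp (y / 12) := Real.one_le_exp (by linarith)
    have hKy : 1 ≤ K * y := by nlinarith
    have hwK : Real.sqrt (K * y) ≤ K * y := Real.sqrt_le_iff.2 ⟨by linarith, by nlinarith⟩
    rw [div_le_iff₀ (by positivity)]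
    rw [div_mul_eq_mul_div, div_le_iff₀ hε] at h
    calc (y + 2) * Real.sqrt (K * y) ≤ (3 * y) * (K * y) := by
          gcongr
          linarith
      _ = 3 * K * y ^ 2 := by ring
      _ ≤ Real.exp (y / 12) ^ 1 * ε := by rwa [pow_one]
      _ ≤ Real.exp (y / 12) ^ 6 * ε := by
          gcongr
          norm_num
      _ = _ := mul_comm _ _
  refine ⟨hsmall, ?_⟩
  have h := ae_eventually_notMem_of_eventually_measure_le (μ := μ) (B := fun n =>
    ⋃ j ∈ Finset.Icc (-(⌈Real.log n⌉₊ + 1 : ℕ) : ℤ) (⌈Real.log n⌉₊ + 1 : ℕ),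
      {ω | Real.sqrt (K * Real.log n / n) <
        |(empDF X n ω (ξ + j * Real.sqrt (K * Real.log n / n)) - empDF X n ω ξ) -
          (F (ξ + j * Real.sqrt (K * Real.log n / n)) - F ξ)|}) ?_
  · filter_upwards [h] with ω hω
    filter_upwards [hω] with n hn
    simpa only [mem_iUnion, mem_ofPred_eq, not_exists, not_lt] using hn
  filter_upwards [hsmall, eventually_exists_block_bound hK hd (sq_nonneg
    (∑' n : ℕ, Real.sqrt (phiCoef X μ (n + 1)))), eventually_ge_atTop 1] with n hsm hb hn
  obtain ⟨q, hq, s, hs, hs1, hb⟩ := hb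
  have hy := Real.log_natCast_nonneg n
  set L := Real.sqrt (K * Real.log n / n)
  set J := ⌈Real.log n⌉₊ + 1 with hJ
  have hL : 0 ≤ L := Real.sqrt_nonneg _
  have hJle : (J : ℝ) ≤ Real.log n + 2 := by
    rw [hJ]
    push_cast
    linarith [Nat.ceil_lt_add_one hy]
  set M := d * ((Real.log n + 2) * L) with hM
  have hM0 : 0 ≤ M := by positivity
  have hb := hb M (phiCoef X μ q) hM0 (phiCoef_nonneg q) le_rfl (sq_mul_phiCoef_le hanti hsum q)
  refine (measure_biUnion_finset_le _ _).trans ((Finset.sum_le_card_nsmul _ _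
    (q * (2 * ENNReal.ofReal (Real.exp
      ((n / q + 1) * (s ^ 2 * M + 2 * phiCoef X μ q) - s * (n * L / q)))))
      fun j hj => ?_).trans ?_)
  · refine (measure_lt_abs_empDF_increment_le hX hF hs hs1 hq hn _ _ _).trans ?_
    gcongr
    have hjJ : |(j : ℝ)| ≤ J := by
      obtain ⟨h1, h2⟩ := Finset.mem_Icc.1 hj
      exact_mod_cast abs_le.2 ⟨h1, h2⟩
    have hdist : |ξ + j * L - ξ| ≤ (Real.log n + 2) * L := by
      rw [add_sub_cancel_left, abs_mul, abs_of_nonneg hL]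
      exact mul_le_mul_of_nonneg_right (hjJ.trans hJle) hL
    exact (hLip _ (hdist.trans hsm)).trans (mul_le_mul_of_nonneg_left hdist hd)
  · have hb : (2 * J + 1) * (q * (2 * Real.exp
        ((n / q + 1) * (s ^ 2 * M + 2 * phiCoef X μ q) - s * (n * L / q)))) ≤ 1 / (n : ℝ) ^ 2 := by
      refine le_trans (mul_le_mul_of_nonneg_right ?_ (by positivity)) hb
      linarith
    refine le_trans (le_of_eq ?_) (ENNReal.ofReal_le_ofReal hb)
    rw [Int.card_Icc, nsmul_eq_mul, ENNReal.ofReal_mul (by positivity),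
      ENNReal.ofReal_mul (by positivity), ENNReal.ofReal_mul (by positivity),
      ENNReal.ofReal_natCast, ENNReal.ofReal_ofNat,
      show (2 * J + 1 : ℝ) = ((2 * J + 1 : ℕ) : ℝ) by push_cast; rfl, ENNReal.ofReal_natCast]
    congr 2
    omega

end PhiMixing

/-- **Theorem 2.3.** For a φ-mixing sequence with `∑ φ^{1/2}(n) < ∞` and a marginal
distribution function `F` with positive continuous density `f` near `ξ_p` with
`d = sup f` there, for any `θ > 0`, with probability 1,
`sup_{x ∈ [ξ_p - τ_n, ξ_p + τ_n]} |(F_n(x) - F(x)) - (F_n(ξ_p) - p)|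
  ≤ (1 + d) ((16C₃ + θ) log n / n)^{1/2}`
for all sufficiently large `n`, where
`τ_n = √(16C₃ + θ) (log n)^{3/2} / (n^{1/2} (log log n)^{1/2})` and
`C₃ = 4[1 + 4 ∑_{n=1}^∞ φ^{1/2}(n)]`. -/
theorem bahadur_thm_2_3 {Ω : Type*} [MeasurableSpace Ω] (μ : Measure Ω)
    [IsProbabilityMeasure μ]
    (X : ℕ → Ω → ℝ) (hX : ∀ i, Measurable (X i))
    (hanti : Antitone (phiCoef X μ))
    (hmix : Tendsto (phiCoef X μ) atTop (nhds 0))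
    (hsum : Summable fun n : ℕ => Real.sqrt (phiCoef X μ (n + 1)))
    (F : ℝ → ℝ) (hF : ∀ i, 1 ≤ i → ∀ x, F x = (μ {ω | X i ω ≤ x}).toReal)
    (p : ℝ) (hp : 0 < p ∧ p < 1)
    (Np : Set ℝ) (hNp : Np ∈ nhds (quantile F p))
    (f : ℝ → ℝ) (hfc : ContinuousOn f Np) (hfpos : ∀ x ∈ Np, 0 < f x)
    (hFf : ∀ x ∈ Np, HasDerivAt F (f x) x)
    (d : ℝ) (hd : IsLUB (f '' Np) d) (hd0 : 0 < d)
    (θ : ℝ) (hθ : 0 < θ)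
    (C3 : ℝ) (hC3 : C3 = 4 * (1 + 4 * ∑' n : ℕ, Real.sqrt (phiCoef X μ (n + 1))))
    (τ : ℕ → ℝ)
    (hτ : ∀ n : ℕ, τ n = Real.sqrt (16 * C3 + θ) * Real.log n ^ ((3 : ℝ) / 2) /
      ((n : ℝ) ^ ((1 : ℝ) / 2) * Real.log (Real.log n) ^ ((1 : ℝ) / 2))) :
    ∀ᵐ ω ∂μ, ∀ᶠ n : ℕ in atTop,
      sSup ((fun x => |(empDF X n ω x - F x) - (empDF X n ω (quantile F p) - p)|) ''
          Set.Icc (quantile F p - τ n) (quantile F p + τ n)) ≤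
        (1 + d) * ((16 * C3 + θ) * Real.log n / n) ^ ((1 : ℝ) / 2) := by
  have hF' : ∀ i, 1 ≤ i → ∀ x, F x = μ.real {ω | X i ω ≤ x} := hF
  set ξ := quantile F p with hξ
  set K := 16 * C3 + θ with hKdef
  have hK : 1 ≤ K := by
    have : 0 ≤ ∑' n : ℕ, Real.sqrt (phiCoef X μ (n + 1)) := tsum_nonneg fun _ => Real.sqrt_nonneg _
    rw [hKdef, hC3]
    linarith
  have hFcdf : F = ProbabilityTheory.cdf (μ.map (X 1)) := by
    have := Measure.isProbabilityMeasure_map (μ := μ) (hX 1).aemeasurable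
    ext x
    rw [ProbabilityTheory.cdf_eq_real, map_measureReal_apply (hX 1) measurableSet_Iic, hF' 1 le_rfl]
    rfl
  have hFξ : F ξ = p := by
    refine PhiMixing.apply_quantile_of_continuousAt ?_ ?_ ?_ hp.1 hp.2
      (hFf ξ (mem_of_mem_nhds hNp)).continuousAt
    · rw [hFcdf]
      exact ProbabilityTheory.monotone_cdf _
    · rw [hFcdf]
      exact ProbabilityTheory.tendsto_cdf_atBot _
    · rw [hFcdf]
      exact ProbabilityTheory.tendsto_cdf_atTop _
  obtain ⟨ε, hε, hball⟩ := Metric.nhds_basis_closedBall.mem_iff.1 hNp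
  have hLip : ∀ x y, |x - ξ| ≤ ε → |y - ξ| ≤ ε → |F x - F y| ≤ d * |x - y| := by
    intro x y hx hy
    refine (convex_closedBall ξ ε).norm_image_sub_le_of_norm_hasDerivWithin_le (f' := f)
      (fun z hz => (hFf z (hball hz)).hasDerivWithinAt) (fun z hz => ?_) hy hx
    rw [Real.norm_of_nonneg (hfpos z (hball hz)).le]
    exact hd.1 (mem_image_of_mem f (hball hz))
  obtain ⟨hsmall, hgrid⟩ := PhiMixing.ae_eventually_grid_le hX hanti hsum hF' hd0.le hε hK
    fun x hx => hLip x ξ hx (by simpa using hε.le)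
  have hlog : Tendsto (fun n : ℕ => Real.log n) atTop atTop :=
    Real.tendsto_log_atTop.comp tendsto_natCast_atTop_atTop
  filter_upwards [hgrid] with ω hω
  filter_upwards [hω, hsmall, hlog.eventually_ge_atTop 1,
    (Real.tendsto_log_atTop.comp hlog).eventually_ge_atTop 1, eventually_ge_atTop 1]
    with n hgrid hsmall hy hyy hn
  simp only [Function.comp_apply] at hyy
  have hn0 : (0 : ℝ) < n := by exact_mod_cast hn
  rw [← Real.sqrt_eq_rpow]
  have hL : 0 < Real.sqrt (K * Real.log n / n) := by positivity
  have hτle : τ n ≤ Real.log n * Real.sqrt (K * Real.log n / n) := by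
    rw [hτ, ← Real.sqrt_eq_rpow, ← Real.sqrt_eq_rpow, show (3 : ℝ) / 2 = 1 + 1 / 2 by norm_num,
      Real.rpow_add (by linarith), Real.rpow_one, ← Real.sqrt_eq_rpow,
      Real.sqrt_div (by positivity), Real.sqrt_mul (by positivity)]
    calc Real.sqrt K * (Real.log n * Real.sqrt (Real.log n)) /
          (Real.sqrt n * Real.sqrt (Real.log (Real.log n)))
        ≤ Real.sqrt K * (Real.log n * Real.sqrt (Real.log n)) / (Real.sqrt n * 1) := by
          gcongr
          exact Real.one_le_sqrt.2 hyy
      _ = _ := by rw [mul_one]; ring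
  set L := Real.sqrt (K * Real.log n / n)
  refine Real.sSup_le ?_ (by positivity)
  rintro _ ⟨x, hx, rfl⟩
  have hJ1 := Nat.le_ceil (Real.log n)
  have hJ2 := Nat.ceil_lt_add_one (show 0 ≤ Real.log n by linarith)
  have key := PhiMixing.abs_sub_le_of_grid (G := fun x => empDF X n ω x - empDF X n ω ξ)
    (H := fun x => F x - F ξ) (ξ := ξ) (d := d) (x := x)
    (fun x y hxy => sub_le_sub_right (PhiMixing.empDF_mono n ω hxy) _) hL hd0.le hgrid ?_ ?_
  · simp only [hFξ] at key
    convert key using 2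
    ring
  · intro x y hx hy
    have hJL : ((⌈Real.log n⌉₊ + 1 : ℕ) : ℝ) * L ≤ ε := by
      refine le_trans (mul_le_mul_of_nonneg_right ?_ hL.le) hsmall
      push_cast
      linarith
    simpa using hLip x y (hx.trans hJL) (hy.trans hJL)
  · push_cast
    rw [add_sub_cancel_right]
    refine le_trans (abs_le.2 ⟨?_, ?_⟩) (hτle.trans (mul_le_mul_of_nonneg_right hJ1 hL.le))
    · linarith [hx.1]
    · linarith [hx.2]
end
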